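/- (Central limit theorem for Chebyshev traces of the UME) Fix an integer k ≥ 3. For each N ≥ 3, let M_N be distributed according to the uni-modular ensemble of dimension N, W_N = M_N/(2√(N−2)), and F_n(M_N) = Tr[T_n(W_N)] − ⟨Tr[T_n(W_N)]⟩ for n = 3, …, k. Then the ℝ^{k−2}-valued random vector F(M_N) = (F_3(M_N), …, F_k(M_N)) converges in distribution as N → ∞ to Z = (Z_3, …, Z_k), where the Z_n are independent centered Gaussian random variables with variance ⟨Z_n²⟩ = n/4. -/

import Mathlib

open MeasureTheory Matrix

noncomputable section

/-- The uniform probability measure on `[0, 2π)`. -/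
def uniformPhase : Measure ℝ :=
  (ENNReal.ofReal (2 * Real.pi))⁻¹ • volume.restrict (Set.Ico 0 (2 * Real.pi))

/-- Product measure: the phases `ω μ ν` (used for `μ < ν`) are i.i.d. uniform on `[0, 2π)`. -/
def phaseMeasure (N : ℕ) : Measure (Fin N → Fin N → ℝ) :=
  Measure.pi fun _ => Measure.pi fun _ => uniformPhase

/-- Antisymmetrized phases built from a raw sample: `φ ν μ = - φ μ ν`, `φ μ μ = 0`. -/
def phases (N : ℕ) (ω : Fin N → Fin N → ℝ) : Fin N → Fin N → ℝ :=
  fun μ ν => if μ < ν then ω μ ν else if ν < μ then - (ω ν μ) else 0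

/-- The uni-modular matrix with phases `φ`: zero diagonal, `M μ ν = exp(i φ μ ν)` off diagonal. -/
def umeMatrix (N : ℕ) (φ : Fin N → Fin N → ℝ) : Matrix (Fin N) (Fin N) ℂ :=
  fun μ ν => if μ = ν then 0 else Complex.exp (Complex.I * (φ μ ν : ℂ))


/-- The scaled UME matrix `W = M / (2√(N−2))`. -/
def scaledUme (N : ℕ) (φ : Fin N → Fin N → ℝ) : Matrix (Fin N) (Fin N) ℂ :=
  ((1 / (2 * Real.sqrt ((N : ℝ) - 2)) : ℝ) : ℂ) • umeMatrix N φ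

/-- `Tr[T_n(W)]`, the trace of the `n`-th Chebyshev polynomial of the first kind evaluated
at the scaled UME matrix `W = M/(2√(N−2))`. -/
def chebTrace (N : ℕ) (φ : Fin N → Fin N → ℝ) (n : ℕ) : ℂ :=
  Matrix.trace (Polynomial.aeval (scaledUme N φ) (Polynomial.Chebyshev.T ℂ n))

open scoped NNReal

/-- The centered trace `F_n(M) = Tr[T_n(W)] − ⟨Tr[T_n(W)]⟩` (a real number, since the trace
of a real polynomial of a Hermitian matrix is real), as a function of the phase sample. -/
def centeredChebTrace (N : ℕ) (n : ℕ) (ω : Fin N → Fin N → ℝ) : ℝ :=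
  (chebTrace N (phases N ω) n
    - ∫ ω', chebTrace N (phases N ω') n ∂(phaseMeasure N)).re

/-- The distribution of `Z = (Z_3, …, Z_k)`: independent centered Gaussians,
`Z_n` of variance `n/4`, with coordinate `i : Fin (k-2)` corresponding to `n = i + 3`. -/
def gaussLimit (k : ℕ) : Measure (Fin (k - 2) → ℝ) :=
  Measure.pi fun i => ProbabilityTheory.gaussianReal 0 ((((i : ℕ) : ℝ≥0) + 3) / 4)

section
open MeasureTheory Matrix Filter Topology
noncomputable section

instance uniformPhase_prob : IsProbabilityMeasure uniformPhase := by
  constructor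
  have h : (0:ℝ) < 2 * Real.pi := by positivity
  simp only [uniformPhase, Measure.smul_apply, smul_eq_mul, Measure.restrict_apply MeasurableSet.univ,
    Set.univ_inter, Real.volume_Ico, sub_zero]
  exact ENNReal.inv_mul_cancel (by simpa using h) ENNReal.ofReal_ne_top

instance phaseMeasure_prob (N : ℕ) : IsProbabilityMeasure (phaseMeasure N) := by
  unfold phaseMeasure; infer_instance

instance gaussLimit_prob (k : ℕ) : IsProbabilityMeasure (gaussLimit k) := by
  unfold gaussLimit; infer_instance

lemma continuous_phases (N : ℕ) : Continuous (phases N) := by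
  refine continuous_pi fun a => continuous_pi fun b => ?_
  unfold phases
  split_ifs <;> fun_prop

/-- The UME matrix as a function of the sample. -/
def ume (N : ℕ) (ω : Fin N → Fin N → ℝ) : Matrix (Fin N) (Fin N) ℂ := umeMatrix N (phases N ω)

lemma continuous_ume (N : ℕ) : Continuous (ume N) := by
  refine continuous_pi fun a => continuous_pi fun b => ?_
  unfold ume umeMatrix
  split_ifs
  · exact continuous_const
  · have := (continuous_apply_apply a b).comp (continuous_phases N)
    simp only [Function.comp_def] at this
    fun_prop

lemma continuous_chebTrace (N n : ℕ) : Continuous (fun ω => chebTrace N (phases N ω) n) := by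
  unfold chebTrace
  refine Continuous.matrix_trace ?_
  refine (Polynomial.continuous_aeval _).comp ?_
  refine continuous_pi fun a => continuous_pi fun b => ?_
  exact continuous_const.mul ((continuous_apply_apply a b).comp (continuous_ume N))

lemma continuous_centered (N n : ℕ) : Continuous (centeredChebTrace N n) := by
  unfold centeredChebTrace
  exact Complex.continuous_re.comp ((continuous_chebTrace N n).sub continuous_const)

theorem levy_reduction (k : ℕ)
    (h : ∀ t : Fin (k - 2) → ℝ, Tendsto (fun N : ℕ => ∫ ω, Complex.exp
        (((∑ i, t i * centeredChebTrace N ((i : ℕ) + 3) ω : ℝ) : ℂ) * Complex.I) ∂(phaseMeasure N))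
        atTop (𝓝 (Complex.exp ((-(∑ i, t i ^ 2 * (((i : ℕ) + 3 : ℝ) / 4)) / 2 : ℝ))))) :
    ∀ f : (Fin (k - 2) → ℝ) → ℝ, Continuous f → (∃ C : ℝ, ∀ x, |f x| ≤ C) →
      Filter.Tendsto
        (fun N : ℕ =>
          ∫ ω, f (fun i => centeredChebTrace N ((i : ℕ) + 3) ω) ∂(phaseMeasure N))
        Filter.atTop (nhds (∫ z, f z ∂(gaussLimit k))) := by
  intro f hf ⟨C, hC⟩
  let E := EuclideanSpace ℝ (Fin (k - 2))
  let F : (N : ℕ) → (Fin N → Fin N → ℝ) → E := fun N ω =>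
    WithLp.toLp 2 (fun i => centeredChebTrace N ((i : ℕ) + 3) ω)
  have hFc : ∀ N, Continuous (F N) := by
    intro N
    refine (PiLp.continuous_toLp 2 _).comp ?_
    exact continuous_pi fun i => continuous_centered N _
  have hFm : ∀ N, Measurable (F N) := fun N => (hFc N).measurable
  let μ : ℕ → ProbabilityMeasure E := fun N =>
    ⟨(phaseMeasure N).map (F N), Measure.isProbabilityMeasure_map (hFm N).aemeasurable⟩
  have hLm : Measurable (WithLp.toLp 2 : (Fin (k-2) → ℝ) → E) :=
    (PiLp.continuous_toLp 2 _).measurable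
  let μ0 : ProbabilityMeasure E :=
    ⟨(gaussLimit k).map (WithLp.toLp 2), Measure.isProbabilityMeasure_map hLm.aemeasurable⟩
  have key : Tendsto μ atTop (𝓝 μ0) := by
    apply ProbabilityMeasure.tendsto_of_tendsto_charFun
    intro t
    have h1 : charFun (μ0 : Measure E) t =
        Complex.exp ((-(∑ i, t i ^ 2 * (((i : ℕ) + 3 : ℝ) / 4)) / 2 : ℝ)) := by
      change charFun ((gaussLimit k).map (WithLp.toLp 2)) t = _
      unfold gaussLimit
      rw [charFun_pi]
      simp_rw [ProbabilityTheory.charFun_gaussianReal]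
      rw [← Complex.exp_sum]
      congr 1
      push_cast
      rw [neg_div, Finset.sum_div, ← Finset.sum_neg_distrib]
      refine Finset.sum_congr rfl fun i _ => ?_
      ring
    have h2 : ∀ N, charFun (μ N : Measure E) t = ∫ ω, Complex.exp
        (((∑ i, t i * centeredChebTrace N ((i : ℕ) + 3) ω : ℝ) : ℂ) * Complex.I)
          ∂(phaseMeasure N) := by
      intro N
      change charFun ((phaseMeasure N).map (F N)) t = _
      rw [charFun_apply, integral_map (hFm N).aemeasurable (by fun_prop)]
      refine integral_congr_ae (Eventually.of_forall fun ω => ?_)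
      simp only [F]
      congr 3
    rw [h1]
    simp_rw [h2]
    exact h (fun i => t i)
  rw [ProbabilityMeasure.tendsto_iff_forall_integral_tendsto] at key
  have hfo : Continuous (fun x : E => f (WithLp.ofLp x)) := hf.comp (PiLp.continuous_ofLp 2 _)
  let g : BoundedContinuousFunction E ℝ := BoundedContinuousFunction.ofNormedAddCommGroup
    (fun x : E => f (WithLp.ofLp x)) hfo C (fun x => by
      simpa [Real.norm_eq_abs] using hC (WithLp.ofLp x))
  have := key g
  have e1 : ∀ N, ∫ x, g x ∂(μ N : Measure E) =
      ∫ ω, f (fun i => centeredChebTrace N ((i : ℕ) + 3) ω) ∂(phaseMeasure N) := by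
    intro N
    change ∫ x, g x ∂((phaseMeasure N).map (F N)) = _
    rw [integral_map (hFm N).aemeasurable g.continuous.aestronglyMeasurable]
    rfl
  have e2 : ∫ x, g x ∂(μ0 : Measure E) = ∫ z, f z ∂(gaussLimit k) := by
    change ∫ x, g x ∂((gaussLimit k).map (WithLp.toLp 2)) = _
    rw [integral_map hLm.aemeasurable g.continuous.aestronglyMeasurable]
    rfl
  rw [e2] at this
  simpa only [e1] using this

end
end

section
open MeasureTheory Matrix Filter Topology
noncomputable section

/-- Rotation of a phase, staying in `[0, 2π)`. -/
def rotPhase (s θ : ℝ) : ℝ := toIcoMod Real.two_pi_pos 0 (θ + s)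

lemma measurePreserving_rotPhase (s : ℝ) :
    MeasurePreserving (rotPhase s) uniformPhase uniformPhase := by
  have : Fact ((0:ℝ) < 2 * Real.pi) := ⟨Real.two_pi_pos⟩
  have h1 : MeasurePreserving (fun x : ℝ => (x : AddCircle (2 * Real.pi)))
      (volume.restrict (Set.Ico 0 (2 * Real.pi))) volume := by
    have := AddCircle.measurePreserving_mk (2 * Real.pi) 0
    rw [zero_add] at this
    rwa [Measure.restrict_congr_set Ico_ae_eq_Ioc]
  let g : AddCircle (2 * Real.pi) → ℝ := fun z => (AddCircle.equivIco (2 * Real.pi) 0 z : ℝ)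
  have hgm : Measurable g := measurable_subtype_coe.comp
    (AddCircle.measurableEquivIco (2 * Real.pi) 0).measurable
  have h2 : MeasurePreserving g volume (volume.restrict (Set.Ico 0 (2 * Real.pi))) := by
    refine ⟨hgm, ?_⟩
    rw [← h1.map_eq, Measure.map_map hgm h1.measurable]
    have : (g ∘ fun x : ℝ => (x : AddCircle (2 * Real.pi)))
        =ᵐ[volume.restrict (Set.Ico 0 (2 * Real.pi))] id := by
      rw [Filter.EventuallyEq, ae_restrict_iff' measurableSet_Ico]
      refine Eventually.of_forall fun x hx => ?_
      simp only [Function.comp, g, id, AddCircle.coe_equivIco_mk_apply]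
      have := (toIcoMod_eq_self (Real.two_pi_pos) (a := 0) (b := x)).2 (by simpa using hx)
      first
        | exact this
        | (rw [toIcoMod_eq_fract_mul] at this; exact this)
    rw [Measure.map_congr this, Measure.map_id]
  have h3 : MeasurePreserving (fun z : AddCircle (2 * Real.pi) => z + (s : AddCircle (2 * Real.pi)))
      volume volume := measurePreserving_add_right _ _
  have h4 := (h2.comp h3).comp h1
  have h5 : (g ∘ (fun z : AddCircle (2 * Real.pi) => z + (s : AddCircle (2 * Real.pi)))) ∘
      (fun x : ℝ => (x : AddCircle (2 * Real.pi))) = rotPhase s := by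
    funext x
    simp only [Function.comp, g, rotPhase]
    rw [← AddCircle.coe_add, AddCircle.coe_equivIco_mk_apply]
    first
      | rfl
      | rw [toIcoMod_eq_fract_mul]
  rw [h5] at h4
  exact h4.smul_measure _

/-- Rotation of the phase `(x, y)`. -/
def shiftPhase (N : ℕ) (x y : Fin N) (s : ℝ) (ω : Fin N → Fin N → ℝ) : Fin N → Fin N → ℝ :=
  fun a b => (if a = x ∧ b = y then rotPhase s else id) (ω a b)

lemma measurePreserving_shiftPhase (N : ℕ) (x y : Fin N) (s : ℝ) :
    MeasurePreserving (shiftPhase N x y s) (phaseMeasure N) (phaseMeasure N) := by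
  unfold phaseMeasure
  refine measurePreserving_pi (f := fun a (g : Fin N → ℝ) (b : Fin N) =>
    (if a = x ∧ b = y then rotPhase s else id) (g b)) _ _ fun a => ?_
  refine measurePreserving_pi (f := fun b => (if a = x ∧ b = y then rotPhase s else id)) _ _
    fun b => ?_
  split_ifs
  · exact measurePreserving_rotPhase s
  · exact MeasurePreserving.id _

/-- signed indicator of the directed edge `(x,y)`. -/
def edgeInd {V : Type*} [DecidableEq V] (x y a b : V) : ℤ :=
  (if a = x ∧ b = y then 1 else 0) - (if a = y ∧ b = x then 1 else 0)

lemma exp_rotPhase (s θ : ℝ) :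
    Complex.exp (Complex.I * (rotPhase s θ : ℂ)) =
      Complex.exp (Complex.I * θ) * Complex.exp (s * Complex.I) := by
  have h : rotPhase s θ = θ + s - toIcoDiv Real.two_pi_pos 0 (θ + s) • (2 * Real.pi) := by
    unfold rotPhase
    exact (self_sub_toIcoDiv_zsmul _ _ _).symm
  rw [h, ← Complex.exp_add]
  rw [Complex.exp_eq_exp_iff_exists_int]
  refine ⟨- toIcoDiv Real.two_pi_pos 0 (θ + s), ?_⟩
  push_cast [zsmul_eq_mul]
  ring

lemma ume_self (N : ℕ) (ω) (x : Fin N) : ume N ω x x = 0 := by simp [ume, umeMatrix]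

lemma phases_antisymm (N : ℕ) (ω) (x y : Fin N) : phases N ω x y = - phases N ω y x := by
  unfold phases
  rcases lt_trichotomy x y with h | h | h
  · simp [h, h.not_gt]
  · simp [h]
  · simp [h, h.not_gt]

lemma ume_eq (N : ℕ) (ω) {x y : Fin N} (h : x ≠ y) :
    ume N ω x y = Complex.exp (Complex.I * (phases N ω x y : ℂ)) := by
  simp [ume, umeMatrix, h]

lemma ume_mul_symm (N : ℕ) (ω) {x y : Fin N} (h : x ≠ y) : ume N ω x y * ume N ω y x = 1 := by
  rw [ume_eq N ω h, ume_eq N ω h.symm, phases_antisymm N ω y x, ← Complex.exp_add]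
  simp

lemma norm_ume (N : ℕ) (ω) {x y : Fin N} (h : x ≠ y) : ‖ume N ω x y‖ = 1 := by
  rw [ume_eq N ω h, mul_comm, Complex.norm_exp_ofReal_mul_I]

lemma norm_ume_le (N : ℕ) (ω) (x y : Fin N) : ‖ume N ω x y‖ ≤ 1 := by
  by_cases h : x = y
  · simp [h, ume_self]
  · exact (norm_ume N ω h).le

lemma conj_ume (N : ℕ) (ω) (x y : Fin N) :
    (starRingEnd ℂ) (ume N ω x y) = ume N ω y x := by
  by_cases h : x = y
  · simp [h, ume_self]
  · rw [ume_eq N ω h, ume_eq N ω (Ne.symm h), phases_antisymm N ω y x, ← Complex.exp_conj]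
    simp

lemma ume_shift_lt (N : ℕ) {x y : Fin N} (h : x < y) (s : ℝ) (ω) (a b : Fin N) :
    ume N (shiftPhase N x y s ω) a b =
      ume N ω a b * Complex.exp (s * (edgeInd x y a b : ℤ) * Complex.I) := by
  by_cases hab : a = b
  · simp [hab, ume_self]
  rw [ume_eq N _ hab, ume_eq N _ hab]
  unfold edgeInd
  by_cases h1 : a = x ∧ b = y
  · obtain ⟨rfl, rfl⟩ := h1
    have : ¬ (a = b ∧ b = a) := fun h => hab h.1
    have e := exp_rotPhase s (ω a b)
    simp [phases, h, shiftPhase, this, e]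
  by_cases h2 : a = y ∧ b = x
  · obtain ⟨rfl, rfl⟩ := h2
    have e := exp_rotPhase s (ω b a)
    have e' := congrArg (fun z => z⁻¹) e
    simp only [mul_inv, ← Complex.exp_neg] at e'
    simp [phases, h, h.not_gt, shiftPhase, h1, e']
  · have h2' : ¬ (b = x ∧ a = y) := fun h => h2 ⟨h.2, h.1⟩
    simp [phases, shiftPhase, h1, h2, h2']

lemma exists_shift (N : ℕ) {x y : Fin N} (h : x ≠ y) :
    ∃ T : ℝ → (Fin N → Fin N → ℝ) → (Fin N → Fin N → ℝ),
      (∀ s, MeasurePreserving (T s) (phaseMeasure N) (phaseMeasure N)) ∧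
      ∀ s ω a b, ume N (T s ω) a b =
        ume N ω a b * Complex.exp (s * (edgeInd x y a b : ℤ) * Complex.I) := by
  rcases lt_or_gt_of_ne h with h | h
  · exact ⟨shiftPhase N x y, measurePreserving_shiftPhase N x y, ume_shift_lt N h⟩
  · refine ⟨fun s => shiftPhase N y x (-s), fun s => measurePreserving_shiftPhase N y x (-s), ?_⟩
    intro s ω a b
    rw [ume_shift_lt N h]
    congr 2
    unfold edgeInd
    push_cast
    ring

/-- Monomial in the entries. -/
def mono (N : ℕ) {ι : Type*} [Fintype ι] (a b : ι → Fin N) (ω : Fin N → Fin N → ℝ) : ℂ :=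
  ∏ i, ume N ω (a i) (b i)

/-- winding number along an edge. -/
def winding {V : Type*} [DecidableEq V] {ι : Type*} [Fintype ι] (a b : ι → V) (x y : V) : ℤ :=
  ∑ i, edgeInd x y (a i) (b i)

def BalSteps {V : Type*} [DecidableEq V] {ι : Type*} [Fintype ι] (a b : ι → V) : Prop :=
  ∀ x y, x ≠ y → winding a b x y = 0

lemma continuous_mono (N : ℕ) {ι : Type*} [Fintype ι] (a b : ι → Fin N) :
    Continuous (mono N a b) := by
  unfold mono
  refine continuous_finsetProd _ fun i _ => ?_
  exact (continuous_apply_apply (a i) (b i)).comp (continuous_ume N)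

lemma norm_mono_le (N : ℕ) {ι : Type*} [Fintype ι] (a b : ι → Fin N) (ω) :
    ‖mono N a b ω‖ ≤ 1 := by
  unfold mono
  rw [norm_prod]
  exact Finset.prod_le_one (fun _ _ => norm_nonneg _) fun i _ => norm_ume_le N ω _ _

lemma mono_shift (N : ℕ) {ι : Type*} [Fintype ι] (a b : ι → Fin N) {x y : Fin N} {s : ℝ} {ω ω'}
    (h : ∀ a b, ume N ω' a b =
        ume N ω a b * Complex.exp (s * (edgeInd x y a b : ℤ) * Complex.I)) :
    mono N a b ω' = mono N a b ω * Complex.exp (s * (winding a b x y : ℤ) * Complex.I) := by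
  unfold mono winding
  simp_rw [h]
  rw [Finset.prod_mul_distrib, ← Complex.exp_sum]
  push_cast
  rw [Finset.mul_sum, Finset.sum_mul]

lemma integrable_mono (N : ℕ) {ι : Type*} [Fintype ι] (a b : ι → Fin N) :
    Integrable (mono N a b) (phaseMeasure N) :=
  Integrable.of_bound (continuous_mono N a b).aestronglyMeasurable 1
    (Eventually.of_forall fun ω => norm_mono_le N a b ω)

lemma integral_mono_eq_zero (N : ℕ) {ι : Type*} [Fintype ι] (a b : ι → Fin N)
    (h : ¬ BalSteps a b) : ∫ ω, mono N a b ω ∂(phaseMeasure N) = 0 := by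
  unfold BalSteps at h
  push Not at h
  obtain ⟨x, y, hxy, hw⟩ := h
  obtain ⟨T, hT, hT2⟩ := exists_shift N hxy
  set w := winding a b x y with hwdef
  set s : ℝ := Real.pi / w
  have h1 : ∫ ω, mono N a b (T s ω) ∂(phaseMeasure N) = ∫ ω, mono N a b ω ∂(phaseMeasure N) := by
    rw [← integral_map (hT s).measurable.aemeasurable
      (continuous_mono N a b).aestronglyMeasurable, (hT s).map_eq]
  have h2 : ∀ ω, mono N a b (T s ω) = - mono N a b ω := by
    intro ω
    rw [mono_shift N a b (hT2 s ω), ← hwdef]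
    have : ((s : ℂ) * (w : ℂ)) = Real.pi := by
      have : (w : ℂ) ≠ 0 := by exact_mod_cast hw
      simp only [s]
      push_cast
      field_simp
    rw [this, Complex.exp_pi_mul_I]
    ring
  simp_rw [h2] at h1
  rw [integral_neg] at h1
  exact neg_eq_self.mp h1 

lemma mono_eq_one (N : ℕ) {ι : Type*} [Fintype ι] (a b : ι → Fin N) (hab : ∀ i, a i ≠ b i)
    (h : BalSteps a b) (ω) : mono N a b ω = 1 := by
  unfold mono
  simp_rw [fun i => ume_eq N ω (hab i)]
  rw [← Complex.exp_sum, ← Finset.mul_sum]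
  have key : ∑ i, phases N ω (a i) (b i) = 0 := by
    have h1 : ∀ c d : Fin N, ∑ x, ∑ y, phases N ω x y * (edgeInd x y c d : ℝ)
        = 2 * phases N ω c d := by
      intro c d
      unfold edgeInd
      push_cast
      simp only [mul_sub, Finset.sum_sub_distrib, ite_and, mul_ite, mul_one, mul_zero]
      simp
      rw [phases_antisymm N ω d c]; ring
    have h2 : 2 * ∑ i, phases N ω (a i) (b i) = 0 := by
      rw [Finset.mul_sum]
      simp_rw [← h1]
      rw [Finset.sum_comm]
      refine Finset.sum_eq_zero fun x _ => ?_
      rw [Finset.sum_comm]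
      refine Finset.sum_eq_zero fun y _ => ?_
      rw [← Finset.mul_sum]
      by_cases hxy : x = y
      · have := phases_antisymm N ω x x
        have : phases N ω x x = 0 := by linarith
        simp [← hxy, this]
      · have := h x y hxy
        unfold winding at this
        have h3 : ∑ i, (edgeInd x y (a i) (b i) : ℝ) = 0 := by exact_mod_cast this
        rw [h3, mul_zero]
    linarith
  have : ∑ i, (phases N ω (a i) (b i) : ℂ) = 0 := by exact_mod_cast key
  rw [this]; simp

end
end

section
open MeasureTheory Matrix Filter Topology
noncomputable section

section NB
set_option linter.unusedSimpArgs false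
variable {V : Type*} [Fintype V] [DecidableEq V]

/-- Weighted end-point incidence matrix. -/
def nbU (M : Matrix V V ℂ) : Matrix (V × V) V ℂ := fun e v => if e.2 = v then M e.1 e.2 else 0
def nbV (_M : Matrix V V ℂ) : Matrix V (V × V) ℂ := fun v e => if e.1 = v then 1 else 0
def nbJ (M : Matrix V V ℂ) : Matrix (V × V) (V × V) ℂ :=
  fun e f => if e.2 = f.1 ∧ e.1 = f.2 then M e.1 e.2 else 0
def nbD (_M : Matrix V V ℂ) : Matrix (V × V) V ℂ := fun e v => if e.1 = v ∧ e.1 ≠ e.2 then 1 else 0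
/-- The non-backtracking matrix. -/
def nbB (M : Matrix V V ℂ) : Matrix (V × V) (V × V) ℂ :=
  fun e f => if e.2 = f.1 ∧ f.2 ≠ e.1 then M e.1 e.2 else 0

lemma nbB_eq (M : Matrix V V ℂ) : nbB M = nbU M * (nbV M) - nbJ M := by
  ext e f
  simp only [nbB, nbU, nbV, nbJ, Matrix.sub_apply, mul_apply, ite_mul, zero_mul, Finset.sum_ite_eq,
    Finset.mem_univ, if_true, mul_ite, mul_one, mul_zero]
  by_cases h1 : e.2 = f.1
  · by_cases h2 : e.1 = f.2
    · simp [h1, h2]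
    · have : f.2 ≠ e.1 := fun h => h2 h.symm
      simp [h1, h2, this]
  · have : f.1 ≠ e.2 := fun h => h1 h.symm
    simp [h1, this]

lemma nbV_mul_nbU (M : Matrix V V ℂ) : (nbV M) * nbU M = M := by
  ext v w
  simp only [nbU, nbV, mul_apply, Fintype.sum_prod_type, ite_mul, zero_mul, one_mul]
  simp

lemma nbV_mul_nbD (M : Matrix V V ℂ) (q : ℂ) (hq : (Fintype.card V : ℂ) = q + 2) :
    ((nbV M) * (nbD M) : Matrix V V ℂ) = (q + 1) • 1 := by
  ext v w
  simp only [nbD, nbV, mul_apply, Fintype.sum_prod_type, ite_mul, zero_mul, one_mul]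
  rw [Finset.sum_eq_single v]
  · by_cases h : v = w
    · subst h
      simp only [if_true, true_and, Matrix.smul_apply, one_apply_eq, smul_eq_mul, mul_one]
      rw [Finset.sum_ite]
      simp only [Finset.sum_const, nsmul_eq_mul, mul_one, mul_zero, add_zero]
      have : (Finset.univ.filter fun x : V => v ≠ x) = Finset.univ.erase v := by
        ext x; simp [eq_comm]
      rw [this, Finset.card_erase_of_mem (Finset.mem_univ _), Finset.card_univ,
        Nat.cast_sub (Fintype.card_pos_iff.2 ⟨v⟩), hq]
      push_cast; ring
    · simp [h]
  · intro b _ hb; simp [hb]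
  · simp

lemma nbJ_mul_apply {κ : Type*} (M : Matrix V V ℂ) (A : Matrix (V × V) κ ℂ) (e : V × V) (v : κ) :
    (nbJ M * A) e v = M e.1 e.2 * A (e.2, e.1) v := by
  rw [mul_apply, Finset.sum_eq_single (e.2, e.1)]
  · simp [nbJ]
  · rintro ⟨x, y⟩ _ h
    have : ¬ (e.2 = x ∧ e.1 = y) := by
      rintro ⟨rfl, rfl⟩; exact h rfl
    simp [nbJ, this]
  · simp

lemma nbJ_mul_nbU (M : Matrix V V ℂ) (h0 : ∀ x, M x x = 0)
    (h1 : ∀ x y, x ≠ y → M x y * M y x = 1) : nbJ M * nbU M = (nbD M) := by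
  ext e v
  rw [nbJ_mul_apply]
  simp only [nbU, nbD]
  by_cases h : e.1 = e.2
  · have := h0 e.2
    simp [h, this]
  · simp [h, h1 _ _ h]

lemma nbJ_mul_nbD (M : Matrix V V ℂ) (h0 : ∀ x, M x x = 0) : nbJ M * (nbD M) = nbU M := by
  ext e v
  rw [nbJ_mul_apply]
  simp only [nbU, nbD]
  by_cases h : e.1 = e.2
  · have := h0 e.2
    simp [h, this]
  · have h' : e.2 ≠ e.1 := fun h2 => h h2.symm
    simp [h']

lemma nbJ_cube (M : Matrix V V ℂ) (h0 : ∀ x, M x x = 0)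
    (h1 : ∀ x y, x ≠ y → M x y * M y x = 1) : nbJ M * (nbJ M * nbJ M) = nbJ M := by
  ext e f
  rw [nbJ_mul_apply, nbJ_mul_apply]
  by_cases h : e.1 = e.2
  · have := h0 e.2
    simp [nbJ, h, this]
  · have := h1 _ _ h
    rw [← mul_assoc, this, one_mul]

lemma trace_nbJ (M : Matrix V V ℂ) (h0 : ∀ x, M x x = 0) : trace (nbJ M) = 0 := by
  simp only [trace, diag, nbJ]
  refine Finset.sum_eq_zero fun e _ => ?_
  by_cases h : e.1 = e.2
  · simp [h, h0]
  · have : ¬ (e.2 = e.1) := fun h2 => h h2.symm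
    simp [this]

lemma trace_nbJ_sq (M : Matrix V V ℂ) (h0 : ∀ x, M x x = 0)
    (h1 : ∀ x y, x ≠ y → M x y * M y x = 1) (q : ℂ) (hq : (Fintype.card V : ℂ) = q + 2) :
    trace (nbJ M * nbJ M) = (q + 2) * (q + 1) := by
  have : trace (nbJ M * nbJ M) = ∑ x : V, ∑ y : V, (1 - if x = y then (1:ℂ) else 0) := by
    simp only [trace, diag, nbJ_mul_apply, Fintype.sum_prod_type]
    simp only [nbJ, and_self, if_true]
    refine Finset.sum_congr rfl fun x _ => Finset.sum_congr rfl fun y _ => ?_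
    by_cases h : x = y
    · simp [h, h0]
    · simp [h, h1 _ _ h]
  rw [this]
  simp [Finset.sum_sub_distrib, hq]
  ring

/-- Rescaled Chebyshev polynomials of the second kind. -/
def chebA (q : ℂ) (M : Matrix V V ℂ) : ℕ → Matrix V V ℂ
  | 0 => 1
  | 1 => M
  | (n + 2) => M * chebA q M (n + 1) - q • chebA q M n

/-- Rescaled Chebyshev polynomials of the first kind. -/
def chebP (q : ℂ) (M : Matrix V V ℂ) : ℕ → Matrix V V ℂ
  | 0 => 2
  | 1 => M
  | (n + 2) => M * chebP q M (n + 1) - q • chebP q M n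

lemma chebP_eq (q : ℂ) (M : Matrix V V ℂ) : ∀ n, 
    chebP q M (n + 2) = chebA q M (n + 2) - q • chebA q M n
  | 0 => by
      simp only [chebP, chebA]
      rw [show (2 : Matrix V V ℂ) = 1 + 1 by norm_num, smul_add]; abel
  | 1 => by
      have := chebP_eq q M 0
      rw [chebP, this]
      simp only [chebP, chebA]
      rw [mul_sub]
      simp only [mul_smul_comm, mul_one]
  | (n + 2) => by
      have e1 := chebP_eq q M n
      have e2 := chebP_eq q M (n + 1)
      have a1 : chebA q M (n + 2) = M * chebA q M (n + 1) - q • chebA q M n := rfl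
      have a2 : chebA q M (n + 2 + 2) = M * chebA q M (n + 1 + 2) - q • chebA q M (n + 2) := rfl
      have a3 : chebP q M (n + 2 + 2) = M * chebP q M (n + 1 + 2) - q • chebP q M (n + 2) := rfl
      rw [a3, e2, e1, a2, mul_sub, smul_sub, mul_smul_comm]
      nth_rewrite 3 [a1]
      rw [smul_sub]
      abel

lemma nbB_mul_nbU (M : Matrix V V ℂ) (h0 : ∀ x, M x x = 0)
    (h1 : ∀ x y, x ≠ y → M x y * M y x = 1) (q : ℂ) (hq : (Fintype.card V : ℂ) = q + 2) : nbB M * nbU M = nbU M * M - (nbD M) := by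
  rw [nbB_eq, Matrix.sub_mul, Matrix.mul_assoc, nbV_mul_nbU, nbJ_mul_nbU M h0 h1]

lemma nbB_mul_nbD (M : Matrix V V ℂ) (h0 : ∀ x, M x x = 0)
    (h1 : ∀ x y, x ≠ y → M x y * M y x = 1) (q : ℂ) (hq : (Fintype.card V : ℂ) = q + 2) : nbB M * (nbD M) = q • nbU M := by
  rw [nbB_eq, Matrix.sub_mul, Matrix.mul_assoc, nbV_mul_nbD M q hq, nbJ_mul_nbD M h0, Matrix.mul_smul,
    Matrix.mul_one, add_smul, one_smul, add_sub_cancel_right]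

lemma nbB_pow_mul_nbU (M : Matrix V V ℂ) (h0 : ∀ x, M x x = 0)
    (h1 : ∀ x y, x ≠ y → M x y * M y x = 1) (q : ℂ) (hq : (Fintype.card V : ℂ) = q + 2) (j : ℕ) :
    nbB M ^ (j + 1) * nbU M = nbU M * chebA q M (j + 1) - (nbD M) * chebA q M j := by
  induction j with
  | zero => simp [chebA, nbB_mul_nbU M h0 h1 q hq, Matrix.mul_one]
  | succ j ih =>
    rw [pow_succ', Matrix.mul_assoc, ih, Matrix.mul_sub, ← Matrix.mul_assoc, ← Matrix.mul_assoc,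
      nbB_mul_nbU M h0 h1 q hq, nbB_mul_nbD M h0 h1 q hq]
    rw [show chebA q M (j + 1 + 1) = M * chebA q M (j + 1) - q • chebA q M j from rfl]
    rw [Matrix.sub_mul, Matrix.mul_sub, Matrix.mul_assoc, Matrix.smul_mul, Matrix.mul_smul]
    abel

lemma nbJ_sq_pow_nbU (M : Matrix V V ℂ) (h0 : ∀ x, M x x = 0)
    (h1 : ∀ x y, x ≠ y → M x y * M y x = 1) (q : ℂ) (hq : (Fintype.card V : ℂ) = q + 2) (j : ℕ) :
    nbJ M * (nbJ M * (nbB M ^ j * nbU M)) = nbB M ^ j * nbU M := by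
  have hU : nbJ M * (nbJ M * nbU M) = nbU M := by
    rw [nbJ_mul_nbU M h0 h1, nbJ_mul_nbD M h0]
  have hD : nbJ M * (nbJ M * (nbD M)) = (nbD M) := by
    rw [nbJ_mul_nbD M h0, nbJ_mul_nbU M h0 h1]
  cases j with
  | zero => simpa using hU
  | succ j =>
    rw [nbB_pow_mul_nbU M h0 h1 q hq j, Matrix.mul_sub, Matrix.mul_sub]
    simp only [← Matrix.mul_assoc] at *
    rw [hU, hD]

lemma nbB_pow_expand (M : Matrix V V ℂ) (n : ℕ) : nbB M ^ n = (-nbJ M) ^ n +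
    ∑ j ∈ Finset.range n, nbB M ^ j * nbU M * (nbV M) * (-nbJ M) ^ (n - 1 - j) := by
  induction n with
  | zero => simp
  | succ n ih =>
    rw [Finset.sum_range_succ]
    have e : ∀ j ∈ Finset.range n, nbB M ^ j * nbU M * (nbV M) * (-nbJ M) ^ (n + 1 - 1 - j) =
        (nbB M ^ j * nbU M * (nbV M) * (-nbJ M) ^ (n - 1 - j)) * (-nbJ M) := by
      intro j hj
      rw [Matrix.mul_assoc _ _ (-nbJ M), ← pow_succ]
      congr 2
      have := Finset.mem_range.1 hj
      omega
    rw [Finset.sum_congr rfl e, ← Finset.sum_mul]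
    have e2 : nbB M ^ (n+1) = nbB M ^ n * (-nbJ M) + nbB M ^ n * nbU M * (nbV M) := by
      rw [pow_succ]
      conv_lhs => rw [show nbB M ^ n * nbB M = nbB M ^ n * (nbU M * (nbV M) - nbJ M) by rw [← nbB_eq]]
      rw [Matrix.mul_sub, Matrix.mul_assoc, Matrix.mul_neg]; abel
    rw [e2]
    have e3 : nbB M ^ n * (-nbJ M) = (-nbJ M) ^ (n + 1) + (∑ j ∈ Finset.range n,
        nbB M ^ j * nbU M * (nbV M) * (-nbJ M) ^ (n - 1 - j)) * (-nbJ M) := by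
      rw [pow_succ, ← Matrix.add_mul, ← ih]
    rw [e3]
    simp only [show n + 1 - 1 - n = 0 by omega, pow_zero, Matrix.mul_one]
    abel

lemma trace_step (M : Matrix V V ℂ) (h0 : ∀ x, M x x = 0)
    (h1 : ∀ x y, x ≠ y → M x y * M y x = 1) (q : ℂ) (hq : (Fintype.card V : ℂ) = q + 2) (n : ℕ) (hn : 1 ≤ n) :
    trace (nbB M ^ (n + 2)) - trace (chebP q M (n + 2)) =
      trace (nbB M ^ n) - trace (chebP q M n) := by
  have hS : ∀ n, trace (nbB M ^ n) = trace ((-nbJ M) ^ n) + ∑ j ∈ Finset.range n,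
      trace ((nbV M) * ((-nbJ M) ^ (n - 1 - j) * (nbB M ^ j * nbU M))) := by
    intro n
    have := congrArg trace (nbB_pow_expand M n)
    rw [this, trace_add, trace_sum]
    congr 1
    refine Finset.sum_congr rfl fun j _ => ?_
    rw [Matrix.mul_assoc, trace_mul_comm, Matrix.mul_assoc]
  have hK : (-nbJ M) ^ (n + 2) = (-nbJ M) ^ n := by
    obtain ⟨m, rfl⟩ : ∃ m, n = m + 1 := ⟨n - 1, by omega⟩
    rw [show m + 1 + 2 = m + 3 by ring, pow_add, pow_add]
    congr 1
    rw [pow_succ, pow_two, pow_one]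
    have := nbJ_cube M h0 h1
    rw [← Matrix.mul_assoc] at this
    simp [this]
  rw [hS (n + 2), hS n, hK, Finset.sum_range_succ, Finset.sum_range_succ]
  have e : ∀ j ∈ Finset.range n,
      trace ((nbV M) * ((-nbJ M) ^ (n + 2 - 1 - j) * (nbB M ^ j * nbU M))) =
      trace ((nbV M) * ((-nbJ M) ^ (n - 1 - j) * (nbB M ^ j * nbU M))) := by
    intro j hj
    have hj := Finset.mem_range.1 hj
    rw [show n + 2 - 1 - j = (n - 1 - j) + 2 by omega, pow_add, Matrix.mul_assoc]
    have : (-nbJ M) ^ 2 * (nbB M ^ j * nbU M) = nbB M ^ j * nbU M := by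
      rw [pow_two, neg_mul_neg, Matrix.mul_assoc, nbJ_sq_pow_nbU M h0 h1 q hq]
    rw [this]
  rw [Finset.sum_congr rfl e]
  rw [show n + 2 - 1 - (n + 1) = 0 by omega, show n + 2 - 1 - n = 1 by omega, pow_zero, pow_one,
    Matrix.one_mul, nbB_pow_mul_nbU M h0 h1 q hq n]
  obtain ⟨m, rfl⟩ : ∃ m, n = m + 1 := ⟨n - 1, by omega⟩
  rw [nbB_pow_mul_nbU M h0 h1 q hq m]
  have f1 : (nbV M) * (nbU M * chebA q M (m + 1 + 1) - (nbD M) * chebA q M (m + 1)) =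
      chebA q M (m + 3) - chebA q M (m + 1) := by
    rw [Matrix.mul_sub, ← Matrix.mul_assoc, ← Matrix.mul_assoc, nbV_mul_nbU, nbV_mul_nbD M q hq,
      Matrix.smul_mul, Matrix.one_mul]
    rw [show chebA q M (m + 3) = M * chebA q M (m + 2) - q • chebA q M (m + 1) from rfl,
      add_smul, one_smul]
    abel
  have f2 : (nbV M) * (-nbJ M * (nbU M * chebA q M (m + 1) - (nbD M) * chebA q M m)) =
      M * chebA q M m - (q + 1) • chebA q M (m + 1) := by
    rw [Matrix.mul_sub, Matrix.neg_mul, Matrix.neg_mul, ← Matrix.mul_assoc (nbJ M),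
      ← Matrix.mul_assoc (nbJ M), nbJ_mul_nbU M h0 h1, nbJ_mul_nbD M h0, Matrix.mul_sub,
      Matrix.mul_neg, Matrix.mul_neg,
      ← Matrix.mul_assoc, ← Matrix.mul_assoc, nbV_mul_nbU, nbV_mul_nbD M q hq,
      Matrix.smul_mul, Matrix.one_mul]
    abel
  rw [f1, f2]
  cases m with
  | zero =>
    rw [chebP_eq q M 1]
    simp only [chebA, chebP, trace_sub, trace_smul, mul_one, smul_eq_mul, zero_add]
    ring
  | succ m =>
    rw [chebP_eq q M (m + 2), chebP_eq q M m]
    have : M * chebA q M (m + 1) = chebA q M (m + 2) + q • chebA q M m := by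
      rw [show chebA q M (m + 2) = M * chebA q M (m + 1) - q • chebA q M m from rfl]; abel
    rw [this]
    simp only [trace_sub, trace_add, trace_smul, smul_eq_mul, 
      show m + 1 + 1 = m + 2 by ring, show m + 1 + 3 = m + 2 + 2 by ring]
    ring

/-- The deterministic Ihara–Bass constant. -/
def ihara (q : ℂ) : ℕ → ℂ
  | 0 => 0
  | 1 => 0
  | 2 => (q + 2) * (q - 1)
  | (n + 3) => ihara q (n + 1)

theorem ihara_bass (M : Matrix V V ℂ) (h0 : ∀ x, M x x = 0)
    (h1 : ∀ x y, x ≠ y → M x y * M y x = 1) (q : ℂ) (hq : (Fintype.card V : ℂ) = q + 2) : ∀ n, 1 ≤ n → trace (nbB M ^ n) - trace (chebP q M n) = ihara q n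
  | 0, h => by omega
  | 1, _ => by
    rw [pow_one, nbB_eq, trace_sub, trace_nbJ M h0, trace_mul_comm, nbV_mul_nbU]
    simp [chebP, ihara]
  | 2, _ => by
    have := nbB_pow_expand M 2
    rw [this]
    simp only [Finset.sum_range_succ, Finset.sum_range_zero, zero_add, trace_add, pow_zero,
      Matrix.one_mul, Nat.sub_zero, pow_one, Matrix.mul_one, pow_two, neg_mul_neg, trace_nbJ_sq M h0 h1 q hq]
    norm_num
    rw [trace_mul_comm, ← Matrix.mul_assoc, nbJ_mul_nbU M h0 h1, trace_mul_comm, nbV_mul_nbD M q hq,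
      trace_mul_comm, nbB_mul_nbU M h0 h1 q hq, Matrix.mul_sub, ← Matrix.mul_assoc, nbV_mul_nbU,
      nbV_mul_nbD M q hq]
    simp only [chebP, ihara, trace_sub, trace_smul, trace_one, smul_eq_mul, hq]
    rw [show (2 : Matrix V V ℂ) = 1 + 1 by norm_num, trace_add, trace_one, hq]
    ring
  | (n + 3), _ => by
    rw [show n + 3 = n + 1 + 2 by ring, trace_step M h0 h1 q hq (n + 1) (by omega),
      ihara_bass M h0 h1 q hq (n + 1) (by omega)]
    rfl

end NB
end
end

section
open MeasureTheory Matrix Filter Topology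
noncomputable section

lemma sum_path {κ : Type*} [Fintype κ] [DecidableEq κ] (A : Matrix κ κ ℂ) (n : ℕ) :
    ∀ X : Matrix κ κ ℂ, ∑ p : Fin (n + 1) → κ,
      (∏ i : Fin n, A (p i.castSucc) (p i.succ)) * X (p (Fin.last n)) (p 0) = trace (A ^ n * X) := by
  induction n with
  | zero =>
    intro X
    simp only [Finset.univ_eq_empty, Finset.prod_empty, one_mul, pow_zero, trace, diag]
    rw [← (Equiv.funUnique (Fin 1) κ).symm.sum_comp]
    rfl
  | succ n ih =>
    intro X
    rw [pow_succ, Matrix.mul_assoc, ← ih (A * X), ← (Fin.snocEquiv fun _ => κ).sum_comp,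
      Fintype.sum_prod_type, Finset.sum_comm]
    refine Finset.sum_congr rfl fun p _ => ?_
    simp only [mul_apply, Finset.mul_sum]
    refine Finset.sum_congr rfl fun z _ => ?_
    rw [Fin.prod_univ_castSucc]
    have h1 : ∀ i : Fin (n + 1), (Fin.snocEquiv fun _ : Fin (n + 2) => κ) (z, p) i.castSucc = p i := by
      intro i; simp [Fin.snocEquiv]
    have h2 : (Fin.snocEquiv fun _ : Fin (n + 2) => κ) (z, p) (Fin.last (n+1)) = z := by
      simp [Fin.snocEquiv]
    have h3 : (Fin.snocEquiv fun _ : Fin (n + 2) => κ) (z, p) 0 = p 0 := by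
      rw [← h1 0]; rfl
    simp only [← Fin.castSucc_succ, h1, h2, h3, Fin.succ_last]
    ring

lemma trace_pow_eq {κ : Type*} [Fintype κ] [DecidableEq κ] (A : Matrix κ κ ℂ) (n : ℕ) :
    trace (A ^ (n + 1)) = ∑ p : Fin (n + 1) → κ,
      ∏ i, A (p i) (p (finRotate (n + 1) i)) := by
  rw [pow_succ, ← sum_path]
  refine Finset.sum_congr rfl fun p _ => ?_
  rw [Fin.prod_univ_castSucc]
  congr 1
  · refine Finset.prod_congr rfl fun i _ => ?_
    rw [finRotate_apply, Fin.coeSucc_eq_succ]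
  · simp

lemma trace_nbB_pow {V : Type*} [Fintype V] [DecidableEq V] (M : Matrix V V ℂ) (n : ℕ) :
    trace (nbB M ^ (n + 1)) = ∑ v : Fin (n + 1) → V,
      if ∀ i, v (finRotate (n + 1) (finRotate (n + 1) i)) ≠ v i then
        ∏ i, M (v i) (v (finRotate (n + 1) i)) else 0 := by
  rw [trace_pow_eq, ← (Equiv.arrowProdEquivProdArrow (Fin (n+1)) (fun _ => V) (fun _ => V)).symm.sum_comp,
    Fintype.sum_prod_type]
  refine Finset.sum_congr rfl fun v _ => ?_
  rw [Finset.sum_eq_single (fun i => v (finRotate (n + 1) i))]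
  · simp only [Equiv.arrowProdEquivProdArrow, Equiv.coe_fn_symm_mk, nbB, true_and]
    split_ifs with h
    · refine Finset.prod_congr rfl fun i _ => ?_
      rw [if_pos (h i)]
    · push Not at h
      obtain ⟨i, hi⟩ := h
      refine Finset.prod_eq_zero (Finset.mem_univ i) ?_
      exact if_neg (fun h => h hi)
  · intro u _ hu
    have : ∃ i, u i ≠ v (finRotate (n + 1) i) := by
      by_contra h; push Not at h; exact hu (funext h)
    obtain ⟨i, hi⟩ := this
    refine Finset.prod_eq_zero (Finset.mem_univ i) ?_
    simp only [Equiv.arrowProdEquivProdArrow, Equiv.coe_fn_symm_mk, nbB, hi, false_and, if_false]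
  · simp

lemma chebP_eq_aeval {V : Type*} [Fintype V] [DecidableEq V] (M W : Matrix V V ℂ) (s : ℂ)
    (hW : (2 * s) • W = M) : ∀ n : ℕ,
    chebP (s ^ 2) M n = (2 * s ^ n) • Polynomial.aeval W (Polynomial.Chebyshev.T ℂ n)
  | 0 => by
      simp only [chebP, pow_zero, mul_one, Nat.cast_zero, Polynomial.Chebyshev.T_zero, map_one]
      rw [two_smul]; norm_num
  | 1 => by
      simp only [chebP, pow_one, Nat.cast_one, Polynomial.Chebyshev.T_one, Polynomial.aeval_X, hW]
  | (n + 2) => by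
      have e1 := chebP_eq_aeval M W s hW n
      have e2 := chebP_eq_aeval M W s hW (n + 1)
      rw [chebP, e1, e2]
      push_cast
      rw [Polynomial.Chebyshev.T_add_two]
      simp only [map_sub, map_mul, Polynomial.aeval_X, map_ofNat]
      rw [← hW, smul_sub, smul_mul_smul_comm, smul_smul]
      congr 1
      · rw [show (2 : Matrix V V ℂ) = (2:ℂ) • 1 by rw [two_smul]; norm_num, smul_mul_assoc, one_mul,
          smul_mul_assoc, smul_smul]
        congr 1; ring
      · congr 1; ring

/-- Closed walks without backtracking. -/
def NBW {V : Type*} {n : ℕ} (v : Fin n → V) : Prop :=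
  ∀ i, v (finRotate n (finRotate n i)) ≠ v i

/-- walk monomial -/
def wm (N : ℕ) {n : ℕ} (v : Fin n → Fin N) (ω : Fin N → Fin N → ℝ) : ℂ :=
  mono N v (fun i => v (finRotate n i)) ω

open Classical in
lemma chebTrace_eq (N n : ℕ) (hN : 3 ≤ N) (ω) :
    chebTrace N (phases N ω) (n + 1) =
      ((1 / (2 * Real.sqrt ((N : ℝ) - 2) ^ (n + 1)) : ℝ) : ℂ) *
        (∑ v : Fin (n + 1) → Fin N, (if NBW v then wm N v ω else 0)) -
      ((1 / (2 * Real.sqrt ((N : ℝ) - 2) ^ (n + 1)) : ℝ) : ℂ) * ihara ((N : ℂ) - 2) (n + 1) := by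
  set s : ℝ := Real.sqrt ((N : ℝ) - 2) with hs
  have hN' : (3 : ℝ) ≤ N := by exact_mod_cast hN
  have hspos : 0 < s := Real.sqrt_pos.2 (by linarith)
  have hs2 : ((s : ℂ)) ^ 2 = (N : ℂ) - 2 := by
    have : s ^ 2 = (N : ℝ) - 2 := Real.sq_sqrt (by linarith)
    exact_mod_cast congrArg (fun x : ℝ => (x : ℂ)) this
  have hsc : (s : ℂ) ≠ 0 := by exact_mod_cast hspos.ne'
  have hW : (2 * (s : ℂ)) • scaledUme N (phases N ω) = ume N ω := by
    unfold scaledUme ume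
    rw [← hs, smul_smul]
    push_cast
    rw [mul_one_div_cancel (by simpa using hsc), one_smul]
  have hc := chebP_eq_aeval _ _ _ hW (n + 1)
  have hib := ihara_bass (ume N ω) (ume_self N ω) (fun x y h => ume_mul_symm N ω h) ((N : ℂ) - 2)
    (by simp) (n + 1) (by omega)
  rw [← hs2, hc, trace_smul, trace_nbB_pow, hs2] at hib
  unfold chebTrace
  rw [smul_eq_mul] at hib
  have hib2 : 2 * (s : ℂ) ^ (n + 1) * (trace (Polynomial.aeval (scaledUme N (phases N ω)) (Polynomial.Chebyshev.T ℂ ↑(n + 1)))) = (∑ v : Fin (n + 1) → Fin N, (if NBW v then wm N v ω else 0)) - ihara ((N : ℂ) - 2) (n + 1) := by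
    rw [← hib]
    unfold NBW wm mono
    ring_nf
  rw [← mul_sub, ← hib2]
  push_cast
  field_simp
end
end

section
open MeasureTheory Matrix Filter Topology
noncomputable section

section comb
set_option linter.unusedSectionVars false
variable {V ι : Type*} [DecidableEq V] [Fintype ι] [DecidableEq ι]

lemma winding_eq (a b : ι → V) (x y : V) : winding a b x y =
    ((Finset.univ.filter fun i => a i = x ∧ b i = y).card : ℤ) -
      ((Finset.univ.filter fun i => a i = y ∧ b i = x).card : ℤ) := by
  unfold winding edgeInd
  rw [Finset.sum_sub_distrib, Finset.sum_boole, Finset.sum_boole]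

lemma exists_reverse (σ : Equiv.Perm ι) (v : ι → V) (h1 : ∀ i, v (σ i) ≠ v i)
    (hb : BalSteps v (fun i => v (σ i))) (i : ι) : ∃ j, v j = v (σ i) ∧ v (σ j) = v i := by
  have h := hb (v i) (v (σ i)) (h1 i).symm
  rw [winding_eq] at h
  have hpos : 0 < (Finset.univ.filter fun j => v j = v i ∧ v (σ j) = v (σ i)).card :=
    Finset.card_pos.2 ⟨i, by simp⟩
  have : 0 < (Finset.univ.filter fun j => v j = v (σ i) ∧ v (σ j) = v i).card := by omega
  obtain ⟨j, hj⟩ := Finset.card_pos.1 this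
  exact ⟨j, by simpa using hj⟩

/-- every vertex of a balanced nonbacktracking family is visited at least twice. -/
lemma exists_partner (σ : Equiv.Perm ι) (v : ι → V) (h1 : ∀ i, v (σ i) ≠ v i)
    (h2 : ∀ i, v (σ (σ i)) ≠ v i)
    (hb : BalSteps v (fun i => v (σ i))) (i : ι) : ∃ j, j ≠ i ∧ v j = v i := by
  obtain ⟨j, hj1, hj2⟩ := exists_reverse σ v h1 hb i
  refine ⟨σ j, ?_, hj2⟩
  intro h
  subst h
  exact h2 j hj1.symm

lemma two_mul_card_image_le (v : ι → V) (hp : ∀ i, ∃ j, j ≠ i ∧ v j = v i) :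
    2 * (Finset.univ.image v).card ≤ Fintype.card ι ∧
    (2 * (Finset.univ.image v).card = Fintype.card ι →
      ∀ i, (Finset.univ.filter fun j => v j = v i).card = 2) := by
  have hsum : ∑ x ∈ Finset.univ.image v, (Finset.univ.filter fun j => v j = x).card
      = Fintype.card ι := by
    rw [← Finset.card_eq_sum_card_image]; simp
  have hge : ∀ x ∈ Finset.univ.image v, 2 ≤ (Finset.univ.filter fun j => v j = x).card := by
    intro x hx
    obtain ⟨i, -, rfl⟩ := Finset.mem_image.1 hx
    obtain ⟨j, hji, hj⟩ := hp i
    exact Finset.one_lt_card.2 ⟨j, by simp [hj], i, by simp, hji⟩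
  have hc : ∑ x ∈ Finset.univ.image v, 2 = 2 * (Finset.univ.image v).card := by
    simp [mul_comm]
  constructor
  · rw [← hsum, ← hc]; exact Finset.sum_le_sum hge
  · intro he i
    have := (Finset.sum_eq_sum_iff_of_le hge).1 (by rw [hc, hsum, he])
    exact (this (v i) (Finset.mem_image_of_mem _ (Finset.mem_univ i))).symm

lemma comb_main (σ : Equiv.Perm ι) (v : ι → V) (h1 : ∀ i, v (σ i) ≠ v i)
    (h2 : ∀ i, v (σ (σ i)) ≠ v i)
    (hb : BalSteps v (fun i => v (σ i))) (C : Finset ι) (i0 i1 : ι) (hi : i0 ≠ i1)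
    (hv : v i0 = v i1) (hi0 : i0 ∈ C) (hi1 : i1 ∈ C)
    (hC1 : ∀ k : ℤ, ∀ a ∈ C, (σ ^ k) a ∈ C)
    (hC2 : ∀ a ∈ C, ∃ k : ℤ, (σ ^ k) i0 = a ∨ (σ ^ k) i1 = a)
    (M : V → V → ℂ) (hM : ∀ x y, x ≠ y → M x y * M y x = 1) :
    2 * (Finset.univ.image v).card < Fintype.card ι ∨ ∏ i ∈ C, M (v i) (v (σ i)) = 1 := by
  have hp := exists_partner σ v h1 h2 hb
  obtain ⟨hle, heq⟩ := two_mul_card_image_le v hp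
  rcases lt_or_eq_of_le hle with h | h
  · exact Or.inl h
  right
  have hfib := heq h
  choose τ hτ1 hτ2 using hp
  have huniq : ∀ i j, v j = v i → j ≠ i → j = τ i := by
    intro i j hj hji
    by_contra hne
    have : 2 < (Finset.univ.filter fun j => v j = v i).card :=
      Finset.two_lt_card.2 ⟨i, by simp, j, by simp [hj], τ i, by simp [hτ2], hji.symm,
        (hτ1 i).symm, hne⟩
    have := hfib i
    omega
  have hττ : ∀ i, τ (τ i) = i := fun i =>
    (huniq (τ i) i (hτ2 i).symm (hτ1 i).symm).symm
  have hst : ∀ i, σ (τ (σ i)) = τ i := by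
    intro i
    obtain ⟨j, hj1, hj2⟩ := exists_reverse σ v h1 hb i
    have hjs : j ≠ σ i := by
      rintro rfl; exact h2 i hj2
    have hj : j = τ (σ i) := huniq _ _ hj1 hjs
    rw [← hj]
    refine huniq _ _ hj2 ?_
    intro hh
    rw [← hh] at hj1
    exact h2 j hj1.symm
  have hzp : ∀ (k : ℤ) i, τ ((σ ^ k) i) = (σ ^ (-k)) (τ i) := by
    have hs1 : ∀ i, τ (σ i) = σ⁻¹ (τ i) := fun i => by
      rw [Equiv.Perm.eq_inv_iff_eq, hst]
    have hs2 : ∀ i, τ (σ⁻¹ i) = σ (τ i) := fun i => by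
      have := hst (σ⁻¹ i)
      rw [show σ (σ⁻¹ i) = i by simp] at this
      exact this.symm
    intro k
    induction k using Int.induction_on with
    | zero => simp
    | succ k ih =>
      intro i
      rw [_root_.zpow_add_one, Equiv.Perm.mul_apply, ih, hs1, neg_add, _root_.zpow_add, Equiv.Perm.mul_apply,
        _root_.zpow_neg_one]
    | pred k ih =>
      intro i
      rw [_root_.zpow_sub_one, Equiv.Perm.mul_apply, ih, hs2,
        show -(-(k:ℤ) - 1) = -(-(k:ℤ)) + 1 by ring, _root_.zpow_add_one, Equiv.Perm.mul_apply]
  have hτC : ∀ a ∈ C, τ a ∈ C := by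
    have ht0 : τ i0 = i1 := (huniq i0 i1 hv.symm hi.symm).symm
    have ht1 : τ i1 = i0 := by rw [← ht0, hττ]
    intro a ha
    obtain ⟨k, hk | hk⟩ := hC2 a ha
    · rw [← hk, hzp, ht0]; exact hC1 _ _ hi1
    · rw [← hk, hzp, ht1]; exact hC1 _ _ hi0
  have hσC : ∀ a ∈ C, σ a ∈ C := fun a ha => by simpa using hC1 1 a ha
  refine Finset.prod_involution (fun i _ => τ (σ i)) ?_ ?_ ?_ ?_
  · intro i hiC
    rw [hst, hτ2, hτ2]
    exact hM _ _ (h1 i).symm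
  · intro i _ _ he
    have := hτ2 (σ i)
    rw [he] at this
    exact h1 i this.symm
  · intro i hiC; exact hτC _ (hσC _ hiC)
  · intro i _
    rw [hst, hττ]

end comb

lemma card_small_image (N r : ℕ) (hN : 0 < N) (ι : Type*) [Fintype ι] [DecidableEq ι] :
    (Finset.univ.filter fun f : ι → Fin N => (Finset.univ.image f).card ≤ r).card
      ≤ r ^ Fintype.card ι * N ^ r := by
  classical
  have : (Finset.univ.filter fun f : ι → Fin N => (Finset.univ.image f).card ≤ r) ⊆
      Finset.univ.image (fun p : (ι → Fin r) × (Fin r → Fin N) => p.2 ∘ p.1) := by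
    intro f hf
    have hf : (Finset.univ.image f).card ≤ r := by simpa using hf
    simp only [Finset.mem_image, Finset.mem_univ, true_and, Prod.exists]
    by_cases hι : Nonempty ι
    · let e := (Finset.univ.image f).equivFin
      have hpos : 0 < (Finset.univ.image f).card :=
        Finset.card_pos.2 ⟨f hι.some, Finset.mem_image_of_mem _ (Finset.mem_univ _)⟩
      refine ⟨fun i => Fin.castLE hf (e ⟨f i, Finset.mem_image_of_mem _ (Finset.mem_univ i)⟩),
        fun j => if h : (j : ℕ) < (Finset.univ.image f).card then (e.symm ⟨j, h⟩ : Fin N)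
          else f hι.some, ?_⟩
      funext i
      simp
    · have := not_nonempty_iff.1 hι
      exact ⟨isEmptyElim, fun _ => ⟨0, hN⟩, funext fun i => isEmptyElim i⟩
  calc _ ≤ _ := Finset.card_le_card this
    _ ≤ _ := Finset.card_image_le
    _ = _ := by simp
end
end

section
open MeasureTheory Matrix Filter Topology
noncomputable section

lemma conj_mono (N : ℕ) {α : Type*} [Fintype α] (σ : Equiv.Perm α) (v : α → Fin N) (ω) :
    (starRingEnd ℂ) (mono N v (fun i => v (σ i)) ω) = mono N v (fun i => v (σ⁻¹ i)) ω := by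
  unfold mono
  rw [map_prod]
  simp_rw [conj_ume]
  rw [← Equiv.prod_comp σ (fun i => ume N ω (v i) (v (σ⁻¹ i)))]
  simp

lemma mono_mul_conj (N : ℕ) {α : Type*} [Fintype α] (σ : Equiv.Perm α) (v v' : α → Fin N) (ω) :
    mono N v (fun i => v (σ i)) ω * (starRingEnd ℂ) (mono N v' (fun i => v' (σ i)) ω) =
      mono N (Sum.elim v v') (fun i => Sum.elim v v' (Equiv.Perm.sumCongr σ σ⁻¹ i)) ω := by
  rw [conj_mono]
  unfold mono
  rw [Fintype.prod_sum_type]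
  rfl

lemma sumCongr_zpow {α β : Type*} (σ : Equiv.Perm α) (τ : Equiv.Perm β) (k : ℤ) :
    (Equiv.Perm.sumCongr σ τ) ^ k = Equiv.Perm.sumCongr (σ ^ k) (τ ^ k) := by
  have := map_zpow (Equiv.Perm.sumCongrHom α β) (σ, τ) k
  exact this.symm

lemma pair_small (N : ℕ) {α : Type*} [Fintype α] [DecidableEq α] (σ : Equiv.Perm α)
    (v v' : α → Fin N)
    (h1 : ∀ i, v (σ i) ≠ v i) (h2 : ∀ i, v (σ (σ i)) ≠ v i)
    (h1' : ∀ i, v' (σ i) ≠ v' i) (h2' : ∀ i, v' (σ (σ i)) ≠ v' i)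
    (hx : ∃ i0 i1, i0 ≠ i1 ∧ v i0 = v i1 ∧ ∀ a, ∃ k : ℤ, (σ ^ k) i0 = a ∨ (σ ^ k) i1 = a)
    (hnb : ¬ BalSteps v (fun i => v (σ i)))
    (hb : BalSteps (Sum.elim v v') (fun i => Sum.elim v v' (Equiv.Perm.sumCongr σ σ⁻¹ i))) :
    (Finset.univ.image (Sum.elim v v')).card ≤ Fintype.card α - 1 := by
  obtain ⟨i0, i1, hi, hv, hC⟩ := hx
  have H1 : ∀ i, Sum.elim v v' (Equiv.Perm.sumCongr σ σ⁻¹ i) ≠ Sum.elim v v' i := by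
    rintro (i | i)
    · exact h1 i
    · have := h1' (σ⁻¹ i)
      simp only [Equiv.Perm.sumCongr_apply, Sum.map_inr, Sum.elim_inr]
      intro h
      apply this
      rw [h]; simp
  have H2 : ∀ i, Sum.elim v v' (Equiv.Perm.sumCongr σ σ⁻¹ (Equiv.Perm.sumCongr σ σ⁻¹ i))
      ≠ Sum.elim v v' i := by
    rintro (i | i)
    · exact h2 i
    · have := h2' (σ⁻¹ (σ⁻¹ i))
      simp only [Equiv.Perm.sumCongr_apply, Sum.map_inr, Sum.elim_inr]
      intro h
      apply this
      rw [h]; simp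
  by_contra hcon
  have key : ∀ ω, mono N v (fun i => v (σ i)) ω = 1 := by
    intro ω
    have := comb_main (Equiv.Perm.sumCongr σ σ⁻¹) (Sum.elim v v') H1 H2 hb
      (Finset.univ.map Function.Embedding.inl) (Sum.inl i0) (Sum.inl i1) (by simpa using hi)
      (by simpa using hv) (by simp) (by simp)
      (by
        intro k a ha
        obtain ⟨b, -, rfl⟩ := Finset.mem_map.1 ha
        rw [sumCongr_zpow]; simp)
      (by
        intro a ha
        obtain ⟨b, -, rfl⟩ := Finset.mem_map.1 ha
        obtain ⟨k, hk⟩ := hC b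
        refine ⟨k, ?_⟩
        rw [sumCongr_zpow]; simpa using hk)
      (ume N ω) (fun x y h => ume_mul_symm N ω h)
    rcases this with h | h
    · rw [Fintype.card_sum] at h
      omega
    · rw [Finset.prod_map] at h
      exact h
  have h0 := integral_mono_eq_zero N v (fun i => v (σ i)) hnb
  simp_rw [key] at h0
  simp at h0

open Classical in
lemma var_bound (N : ℕ) (hN : 0 < N) {α : Type*} [Fintype α] [DecidableEq α] (σ : Equiv.Perm α)
    (S : Finset (α → Fin N)) (d : (α → Fin N) → ℂ) (K : ℝ) (hd : ∀ v, ‖d v‖ ≤ K)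
    (h1 : ∀ v ∈ S, ∀ i, v (σ i) ≠ v i) (h2 : ∀ v ∈ S, ∀ i, v (σ (σ i)) ≠ v i)
    (hx : ∀ v ∈ S, ∃ i0 i1, i0 ≠ i1 ∧ v i0 = v i1 ∧
      ∀ a, ∃ k : ℤ, (σ ^ k) i0 = a ∨ (σ ^ k) i1 = a) :
    ∫ ω, ‖∑ v ∈ S, d v * (mono N v (fun i => v (σ i)) ω -
        ∫ ω', mono N v (fun i => v (σ i)) ω' ∂(phaseMeasure N))‖ ^ 2 ∂(phaseMeasure N) ≤
      K ^ 2 * ((Fintype.card α - 1 : ℕ) ^ (2 * Fintype.card α) * N ^ (Fintype.card α - 1) : ℕ) := by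
  set m : (α → Fin N) → (Fin N → Fin N → ℝ) → ℂ := fun v => mono N v (fun i => v (σ i)) with hm
  set S' := S.filter fun v => ¬ BalSteps v (fun i => v (σ i)) with hS'
  have e1 : ∀ ω, ∑ v ∈ S, d v * (m v ω - ∫ ω', m v ω' ∂(phaseMeasure N)) =
      ∑ v ∈ S', d v * m v ω := by
    intro ω
    rw [hS', Finset.sum_filter]
    refine Finset.sum_congr rfl fun v hv => ?_
    by_cases hb : BalSteps v (fun i => v (σ i))
    · have : ∀ ω, m v ω = 1 := mono_eq_one N v _ (fun i => (h1 v hv i).symm) hb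
      rw [if_neg (not_not.2 hb)]
      simp [this]
    · rw [if_pos hb]
      simp only [hm]
      rw [integral_mono_eq_zero N v _ hb, sub_zero]
  refine le_of_eq_of_le (integral_congr_ae (Eventually.of_forall fun ω =>
    congrArg (fun z : ℂ => ‖z‖ ^ 2) (e1 ω))) ?_
  have e2 : ((∫ ω, ‖∑ v ∈ S', d v * m v ω‖ ^ 2 ∂(phaseMeasure N) : ℝ) : ℂ) =
      ∑ v ∈ S', ∑ v' ∈ S', d v * (starRingEnd ℂ) (d v') *
        ∫ ω, mono N (Sum.elim v v') (fun i => Sum.elim v v' (Equiv.Perm.sumCongr σ σ⁻¹ i)) ω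
          ∂(phaseMeasure N) := by
    rw [← integral_complex_ofReal]
    have : ∀ ω, (((‖∑ v ∈ S', d v * m v ω‖ ^ 2 : ℝ)) : ℂ) = ∑ v ∈ S', ∑ v' ∈ S',
        d v * (starRingEnd ℂ) (d v') * mono N (Sum.elim v v') (fun i => Sum.elim v v' (Equiv.Perm.sumCongr σ σ⁻¹ i)) ω := by
      intro ω
      push_cast
      rw [← Complex.mul_conj', map_sum, Finset.sum_mul_sum]
      refine Finset.sum_congr rfl fun v _ => Finset.sum_congr rfl fun v' _ => ?_
      rw [← mono_mul_conj, map_mul]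
      simp only [hm]
      ring
    simp_rw [this]
    rw [integral_finset_sum]
    · refine Finset.sum_congr rfl fun v _ => ?_
      rw [integral_finset_sum]
      · refine Finset.sum_congr rfl fun v' _ => ?_
        rw [integral_const_mul]
      · intro v' _; exact (integrable_mono N _ _).const_mul _
    · intro v _; exact integrable_finset_sum _ fun v' _ => (integrable_mono N _ _).const_mul _
  have hK : 0 ≤ K := (norm_nonneg _).trans (hd (fun _ => ⟨0, hN⟩))
  have e3 : ∀ v ∈ S', ∀ v' ∈ S', ‖d v * (starRingEnd ℂ) (d v') *
        ∫ ω, mono N (Sum.elim v v') (fun i => Sum.elim v v' (Equiv.Perm.sumCongr σ σ⁻¹ i)) ω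
          ∂(phaseMeasure N)‖ ≤
      K ^ 2 * if (Finset.univ.image (Sum.elim v v')).card ≤ Fintype.card α - 1 then 1 else 0 := by
    intro v hv v' hv'
    have hv := Finset.mem_filter.1 hv
    have hv' := Finset.mem_filter.1 hv'
    rw [norm_mul, norm_mul, RCLike.norm_conj, pow_two]
    refine mul_le_mul (mul_le_mul (hd _) (hd _) (norm_nonneg _) hK) ?_ (norm_nonneg _)
      (mul_nonneg hK hK)
    split_ifs with hs
    · refine (norm_integral_le_of_norm_le_const (Eventually.of_forall fun ω => norm_mono_le N _ _ ω)).trans ?_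
      simp
    · rw [integral_mono_eq_zero, norm_zero]
      intro hb
      exact hs (pair_small N σ v v' (h1 v hv.1) (h2 v hv.1) (h1 v' hv'.1) (h2 v' hv'.1)
        (hx v hv.1) hv.2 hb)
  have e4 : ∫ ω, ‖∑ v ∈ S', d v * m v ω‖ ^ 2 ∂(phaseMeasure N) =
      ‖((∫ ω, ‖∑ v ∈ S', d v * m v ω‖ ^ 2 ∂(phaseMeasure N) : ℝ) : ℂ)‖ := by
    rw [Complex.norm_real, Real.norm_of_nonneg]
    exact integral_nonneg fun ω => by positivity
  rw [e4, e2]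
  refine (norm_sum_le_of_le _ fun v hv => norm_sum_le_of_le _ fun v' hv' => e3 v hv v' hv').trans ?_
  simp_rw [← Finset.mul_sum]
  refine mul_le_mul_of_nonneg_left ?_ (sq_nonneg K)
  have hcard := card_small_image N (Fintype.card α - 1) hN (α ⊕ α)
  rw [Fintype.card_sum, ← two_mul] at hcard
  refine le_trans ?_ (Nat.cast_le.2 hcard)
  rw [← Finset.sum_product', Finset.sum_boole]
  refine Nat.cast_le.2 ?_
  refine Finset.card_le_card_of_injOn (fun p => Sum.elim p.1 p.2) ?_ ?_
  · intro p hp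
    have := (Finset.mem_filter.1 hp).2
    simpa using this
  · rintro ⟨a, b⟩ _ ⟨c, e⟩ _ h
    have h := (Equiv.sumArrowEquivProdArrow α α (Fin N)).symm.injective (a₁ := (a, b)) (a₂ := (c, e)) h
    exact h

lemma integral_norm_le_of_sq {Ω : Type*} [MeasurableSpace Ω] (μ : Measure Ω) [IsProbabilityMeasure μ]
    (f : Ω → ℂ) (hf : Integrable f μ) (hf2 : Integrable (fun ω => ‖f ω‖ ^ 2) μ) (B : ℝ)
    (hB : ∫ ω, ‖f ω‖ ^ 2 ∂μ ≤ B) : ∫ ω, ‖f ω‖ ∂μ ≤ Real.sqrt B := by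
  apply Real.le_sqrt_of_sq_le
  refine le_trans ?_ hB
  have : 0 ≤ ∫ ω, (‖f ω‖ - ∫ ω', ‖f ω'‖ ∂μ) ^ 2 ∂μ := integral_nonneg fun ω => sq_nonneg _
  set c := ∫ ω', ‖f ω'‖ ∂μ with hc
  have h2 : ∫ ω, (‖f ω‖ - c) ^ 2 ∂μ = ∫ ω, ‖f ω‖ ^ 2 ∂μ - c ^ 2 := by
    have : ∀ ω, (‖f ω‖ - c) ^ 2 = ‖f ω‖ ^ 2 - 2 * c * ‖f ω‖ + c ^ 2 := fun ω => by ring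
    simp_rw [this]
    have hs : Integrable (fun ω => ‖f ω‖ ^ 2 - 2 * c * ‖f ω‖) μ := hf2.sub (hf.norm.const_mul _)
    rw [integral_add hs (integrable_const _),
      integral_sub hf2 (hf.norm.const_mul _), integral_const_mul, ← hc]
    simp
    ring
  linarith
end
end

section
open MeasureTheory Matrix Filter Topology
noncomputable section

lemma abstract_ibp {Ω κ : Type*} [MeasurableSpace Ω] (μ : Measure Ω) [IsProbabilityMeasure μ]
    (T : ℝ → Ω → Ω) (hT : ∀ s, MeasurePreserving (T s) μ μ)
    (m : Ω → ℂ) (hm : Measurable m) (hm1 : ∀ ω, ‖m ω‖ ≤ 1)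
    (hmT : ∀ s ω, m (T s ω) = m ω * Complex.exp (s * Complex.I))
    (S : Finset κ) (c : κ → ℂ) (d : κ → ℤ) (f : κ → Ω → ℂ) (hf : ∀ w, Measurable (f w))
    (hf1 : ∀ w ω, ‖f w ω‖ ≤ 1)
    (hfT : ∀ w s ω, f w (T s ω) = f w ω * Complex.exp (s * (d w : ℤ) * Complex.I)) (u : ℝ) :
    ∫ ω, m ω * Complex.exp (u * (∑ w ∈ S, c w * f w ω) * Complex.I) ∂μ =
      - Complex.I * u * ∫ ω, m ω * (∑ w ∈ S, c w * d w * f w ω) *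
        Complex.exp (u * (∑ w ∈ S, c w * f w ω) * Complex.I) ∂μ := by
  set E : ℝ → Ω → ℂ := fun s ω => Complex.exp (u * (∑ w ∈ S, c w * (f w ω *
      Complex.exp (s * (d w : ℤ) * Complex.I))) * Complex.I) with hE
  set F : ℝ → Ω → ℂ := fun s ω => m ω * Complex.exp (s * Complex.I) * E s ω with hF
  set D : ℝ → Ω → ℂ := fun s ω => ∑ w ∈ S, c w * (f w ω *
      (Complex.exp (s * (d w : ℤ) * Complex.I) * ((d w : ℤ) * Complex.I))) with hD
  set F' : ℝ → Ω → ℂ := fun s ω => m ω * (Complex.exp (s * Complex.I) * Complex.I) * E s ω +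
      m ω * Complex.exp (s * Complex.I) * (E s ω * (u * D s ω * Complex.I)) with hF'
  have hexp1 : ∀ (s : ℝ) (k : ℤ), ‖Complex.exp (s * (k : ℤ) * Complex.I)‖ = 1 := by
    intro s k
    have : ((s : ℂ) * (k : ℤ)) = ((s * k : ℝ) : ℂ) := by push_cast; rfl
    rw [this, Complex.norm_exp_ofReal_mul_I]
  have hderiv : ∀ ω s, HasDerivAt (fun s => F s ω) (F' s ω) s := by
    intro ω s
    have h0 : HasDerivAt (fun s : ℝ => (s : ℂ)) 1 s := Complex.ofRealCLM.hasDerivAt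
    have h1 : HasDerivAt (fun s : ℝ => Complex.exp (s * Complex.I))
        (Complex.exp (s * Complex.I) * Complex.I) s := by
      simpa using (h0.mul_const Complex.I).cexp
    have h2 : ∀ w, HasDerivAt (fun s : ℝ => c w * (f w ω * Complex.exp (s * (d w : ℤ) * Complex.I)))
        (c w * (f w ω * (Complex.exp (s * (d w : ℤ) * Complex.I) * ((d w : ℤ) * Complex.I)))) s := by
      intro w
      have := (((h0.mul_const ((d w : ℤ) : ℂ)).mul_const Complex.I).cexp.const_mul (f w ω)).const_mul (c w)
      simpa using this
    have h3 : HasDerivAt (fun s => E s ω) (E s ω * (u * D s ω * Complex.I)) s := by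
      have := HasDerivAt.fun_sum (u := S) fun w _ => h2 w
      exact ((this.const_mul (u : ℂ)).mul_const Complex.I).cexp
    exact (h1.const_mul (m ω)).mul h3
  have hEm : ∀ s, Measurable (E s) := by
    intro s
    refine Complex.measurable_exp.comp ?_
    refine Measurable.mul_const (Measurable.const_mul ?_ _) _
    exact Finset.measurable_fun_sum _ fun w _ => ((hf w).mul_const _).const_mul _
  have hDm : ∀ s, Measurable (D s) := by
    intro s
    exact Finset.measurable_fun_sum _ fun w _ => ((hf w).mul_const _).const_mul _
  have hFm : ∀ s, Measurable (F s) := fun s => (hm.mul_const _).mul (hEm s)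
  have hF'm : ∀ s, Measurable (F' s) := fun s =>
    ((hm.mul_const _).mul (hEm s)).add ((hm.mul_const _).mul ((hEm s).mul
      (((hDm s).const_mul _).mul_const _)))
  set A : ℝ := ∑ w ∈ S, ‖c w‖ with hA
  set B : ℝ := ∑ w ∈ S, ‖c w‖ * ‖((d w : ℤ) : ℂ)‖ with hB
  have hEb : ∀ s ω, ‖E s ω‖ ≤ Real.exp (|u| * A) := by
    intro s ω
    refine (Complex.norm_exp_le_exp_norm _).trans (Real.exp_le_exp.2 ?_)
    rw [norm_mul, norm_mul, Complex.norm_I, mul_one, Complex.norm_real, Real.norm_eq_abs]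
    refine mul_le_mul_of_nonneg_left ?_ (abs_nonneg _)
    refine norm_sum_le_of_le _ fun w _ => ?_
    rw [norm_mul, norm_mul, hexp1, mul_one]
    exact mul_le_of_le_one_right (norm_nonneg _) (hf1 w ω)
  have hDb : ∀ s ω, ‖D s ω‖ ≤ B := by
    intro s ω
    refine norm_sum_le_of_le _ fun w _ => ?_
    rw [norm_mul, norm_mul, norm_mul, hexp1, norm_mul, Complex.norm_I, one_mul, mul_one]
    refine mul_le_mul_of_nonneg_left ?_ (norm_nonneg _)
    exact mul_le_of_le_one_left (norm_nonneg _) (hf1 w ω)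
  have hFb : ∀ s ω, ‖F s ω‖ ≤ Real.exp (|u| * A) := by
    intro s ω
    simp only [hF]
    rw [norm_mul, norm_mul, Complex.norm_exp_ofReal_mul_I, mul_one]
    calc _ ≤ 1 * Real.exp (|u| * A) := mul_le_mul (hm1 ω) (hEb s ω) (norm_nonneg _) zero_le_one
      _ = _ := one_mul _
  have hF'b : ∀ s ω, ‖F' s ω‖ ≤ Real.exp (|u| * A) + Real.exp (|u| * A) * (|u| * B) := by
    intro s ω
    simp only [hF']
    refine (norm_add_le _ _).trans (add_le_add ?_ ?_)
    · rw [norm_mul, norm_mul, norm_mul, Complex.norm_exp_ofReal_mul_I, Complex.norm_I, mul_one, mul_one]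
      calc _ ≤ 1 * Real.exp (|u| * A) := mul_le_mul (hm1 ω) (hEb s ω) (norm_nonneg _) zero_le_one
        _ = _ := one_mul _
    · rw [norm_mul, norm_mul, Complex.norm_exp_ofReal_mul_I, mul_one, norm_mul, norm_mul, norm_mul,
        Complex.norm_I, mul_one, Complex.norm_real, Real.norm_eq_abs]
      calc _ ≤ 1 * (Real.exp (|u| * A) * (|u| * B)) := by
            refine mul_le_mul (hm1 ω) ?_ (by positivity) zero_le_one
            refine mul_le_mul (hEb s ω) ?_ (by positivity) (by positivity)
            exact mul_le_mul_of_nonneg_left (hDb s ω) (abs_nonneg _)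
        _ = _ := one_mul _
  have hmain := (hasDerivAt_integral_of_dominated_loc_of_deriv_le (μ := μ) (F := F) (F' := F')
    (x₀ := (0:ℝ)) (s := Set.univ) (bound := fun _ => Real.exp (|u| * A) + Real.exp (|u| * A) * (|u| * B))
    Filter.univ_mem (Eventually.of_forall fun s => (hFm s).aestronglyMeasurable)
    (Integrable.of_bound (hFm 0).aestronglyMeasurable _ (Eventually.of_forall (hFb 0)))
    (hF'm 0).aestronglyMeasurable
    (Eventually.of_forall fun ω s _ => hF'b s ω) (integrable_const _)
    (Eventually.of_forall fun ω s _ => hderiv ω s)).2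
  have hconst : ∀ s, ∫ ω, F s ω ∂μ = ∫ ω, F 0 ω ∂μ := by
    intro s
    have e : ∀ ω, F s ω = F 0 (T s ω) := by
      intro ω
      simp only [hF, hE, hmT, hfT]
      simp
    simp_rw [e]
    rw [← integral_map (f := F 0) (hT s).measurable.aemeasurable (hFm 0).aestronglyMeasurable,
      (hT s).map_eq]
  have hzero : ∫ ω, F' 0 ω ∂μ = 0 := by
    have h2 : HasDerivAt (fun s => ∫ ω, F s ω ∂μ) 0 (0:ℝ) := by
      simp_rw [hconst]
      exact hasDerivAt_const _ _
    exact hmain.unique h2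
  have e1 : ∀ ω, F' 0 ω = Complex.I * (m ω * Complex.exp (u * (∑ w ∈ S, c w * f w ω) * Complex.I)) +
      (-u) * (m ω * (∑ w ∈ S, c w * d w * f w ω) *
        Complex.exp (u * (∑ w ∈ S, c w * f w ω) * Complex.I)) := by
    intro ω
    simp only [hF', hE, hD, Complex.ofReal_zero, zero_mul, Complex.exp_zero, mul_one, one_mul]
    have : ∑ w ∈ S, c w * (f w ω * (d w * Complex.I)) = Complex.I * ∑ w ∈ S, c w * d w * f w ω := by
      rw [Finset.mul_sum]
      exact Finset.sum_congr rfl fun w _ => by ring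
    rw [this]
    linear_combination (m ω * (∑ w ∈ S, c w * d w * f w ω) * u *
      Complex.exp (u * (∑ w ∈ S, c w * f w ω) * Complex.I)) * Complex.I_mul_I
  have e0 : ∀ ω, E 0 ω = Complex.exp (u * (∑ w ∈ S, c w * f w ω) * Complex.I) := by
    intro ω; simp [hE]
  have i1 : Integrable (fun ω => m ω * Complex.exp (u * (∑ w ∈ S, c w * f w ω) * Complex.I)) μ := by
    have : Integrable (F 0) μ :=
      Integrable.of_bound (hFm 0).aestronglyMeasurable _ (Eventually.of_forall (hFb 0))
    refine this.congr (Eventually.of_forall fun ω => ?_)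
    simp only [hF, e0]; simp
  have i2 : Integrable (fun ω => m ω * (∑ w ∈ S, c w * d w * f w ω) *
        Complex.exp (u * (∑ w ∈ S, c w * f w ω) * Complex.I)) μ := by
    refine Integrable.of_bound (C := 1 * B * Real.exp (|u| * A)) ?_ (Eventually.of_forall fun ω => ?_)
    · simp_rw [← e0]
      exact ((hm.mul (Finset.measurable_fun_sum _ fun w _ => ((hf w).const_mul _))).mul
        (hEm 0)).aestronglyMeasurable
    · rw [← e0, norm_mul, norm_mul]
      refine mul_le_mul (mul_le_mul (hm1 ω) ?_ (norm_nonneg _) zero_le_one) (hEb 0 ω)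
        (norm_nonneg _) (by positivity)
      refine norm_sum_le_of_le _ fun w _ => ?_
      rw [norm_mul, norm_mul]
      exact mul_le_of_le_one_right (by positivity) (hf1 w ω)
  simp_rw [e1] at hzero
  rw [integral_add (i1.const_mul _) (i2.const_mul _), integral_const_mul, integral_const_mul] at hzero
  linear_combination (-Complex.I) * hzero + (∫ ω, m ω * Complex.exp (u * (∑ w ∈ S, c w * f w ω) * Complex.I) ∂μ) * Complex.I_mul_I

lemma abstract_stein {Ω : Type*} [MeasurableSpace Ω] (μ : Measure Ω) [IsProbabilityMeasure μ]
    (X : Ω → ℝ) (hX : Measurable X) (B : ℝ) (hXB : ∀ ω, |X ω| ≤ B) (G : Ω → ℂ)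
    (hG : Integrable G μ) (v ε : ℝ) (hv : 0 ≤ v)
    (hstein : ∀ u : ℝ, ∫ ω, (X ω : ℂ) * Complex.exp (u * X ω * Complex.I) ∂μ =
      Complex.I * u * ∫ ω, G ω * Complex.exp (u * X ω * Complex.I) ∂μ)
    (hε : ∫ ω, ‖G ω - v‖ ∂μ ≤ ε) :
    ‖∫ ω, Complex.exp (X ω * Complex.I) ∂μ - Complex.exp ((-v / 2 : ℝ) : ℂ)‖ ≤ ε := by
  set φ : ℝ → ℂ := fun u => ∫ ω, Complex.exp (u * X ω * Complex.I) ∂μ with hφ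
  have hem : ∀ u : ℝ, Measurable fun ω => Complex.exp (u * X ω * Complex.I) := fun u =>
    Complex.measurable_exp.comp (((Complex.measurable_ofReal.comp hX).const_mul _).mul_const _)
  have hen : ∀ (u : ℝ) ω, ‖Complex.exp (u * X ω * Complex.I)‖ = 1 := by
    intro u ω
    rw [show (u : ℂ) * X ω = ((u * X ω : ℝ) : ℂ) by push_cast; rfl, Complex.norm_exp_ofReal_mul_I]
  have hd : ∀ u : ℝ, HasDerivAt φ (- u * ∫ ω, G ω * Complex.exp (u * X ω * Complex.I) ∂μ) u := by
    intro u
    have := (hasDerivAt_integral_of_dominated_loc_of_deriv_le (μ := μ)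
      (F := fun (u : ℝ) ω => Complex.exp (u * X ω * Complex.I))
      (F' := fun (u : ℝ) ω => Complex.exp (u * X ω * Complex.I) * (X ω * Complex.I))
      (x₀ := u) (s := Set.univ) (bound := fun _ => B)
      Filter.univ_mem (Eventually.of_forall fun s => (hem s).aestronglyMeasurable)
      (Integrable.of_bound (hem u).aestronglyMeasurable 1 (Eventually.of_forall fun ω => (hen u ω).le))
      ((hem u).mul ((Complex.measurable_ofReal.comp hX).mul_const _)).aestronglyMeasurable
      (Eventually.of_forall fun ω s _ => by
        rw [norm_mul, hen, one_mul, norm_mul, Complex.norm_I, mul_one, Complex.norm_real]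
        exact hXB ω) (integrable_const _)
      (Eventually.of_forall fun ω s _ => by
        have h0 : HasDerivAt (fun s : ℝ => (s : ℂ)) 1 s := Complex.ofRealCLM.hasDerivAt
        simpa using ((h0.mul_const (X ω : ℂ)).mul_const Complex.I).cexp)).2
    refine this.congr_deriv (Eq.symm ?_)
    have e : ∀ ω, Complex.exp (u * X ω * Complex.I) * (X ω * Complex.I) =
      Complex.I * (X ω * Complex.exp (u * X ω * Complex.I)) := fun ω => by ring
    simp_rw [e]
    rw [integral_const_mul, hstein u]
    linear_combination (- u * ∫ ω, G ω * Complex.exp (u * X ω * Complex.I) ∂μ) * Complex.I_mul_I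
  set ψ : ℝ → ℂ := fun u => Complex.exp (((v * u ^ 2 / 2 : ℝ)) : ℂ) * φ u with hψ
  have hψd : ∀ u : ℝ, HasDerivAt ψ (Complex.exp (((v * u ^ 2 / 2 : ℝ)) : ℂ) * (u *
      ∫ ω, (v - G ω) * Complex.exp (u * X ω * Complex.I) ∂μ)) u := by
    intro u
    have h1 : HasDerivAt (fun u : ℝ => v * u ^ 2 / 2) (v * u) u := by
      have := ((hasDerivAt_pow 2 u).const_mul v).div_const 2
      refine this.congr_deriv ?_
      norm_num; ring
    have h2 := (h1.ofReal_comp).cexp.mul (hd u)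
    refine h2.congr_deriv (Eq.symm ?_)
    have : ∫ ω, (v - G ω) * Complex.exp (u * X ω * Complex.I) ∂μ = v * φ u -
        ∫ ω, G ω * Complex.exp (u * X ω * Complex.I) ∂μ := by
      simp_rw [sub_mul]
      rw [integral_sub, integral_const_mul]
      · exact (Integrable.of_bound (hem u).aestronglyMeasurable 1
          (Eventually.of_forall fun ω => (hen u ω).le)).const_mul _
      · exact hG.mul_bdd (c := 1) (hem u).aestronglyMeasurable (Eventually.of_forall fun ω => (hen u ω).le)
    rw [this]
    push_cast
    ring
  have hε0 : 0 ≤ ε := (integral_nonneg fun ω => norm_nonneg _).trans hε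
  have hseg := norm_image_sub_le_of_norm_deriv_le_segment_01' (f := ψ) (C := Real.exp (v / 2) * ε)
    (fun u _ => (hψd u).hasDerivWithinAt) (by
      intro u hu
      rw [norm_mul, norm_mul, Complex.norm_exp_ofReal, Complex.norm_real, Real.norm_of_nonneg hu.1]
      have b1 : Real.exp (v * u ^ 2 / 2) ≤ Real.exp (v / 2) := by
        apply Real.exp_le_exp.2
        have : u ^ 2 ≤ 1 := by nlinarith [hu.1, hu.2]
        nlinarith
      have b2 : ‖∫ ω, (v - G ω) * Complex.exp (u * X ω * Complex.I) ∂μ‖ ≤ ε := by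
        refine (norm_integral_le_integral_norm _).trans (le_trans (le_of_eq ?_) hε)
        refine integral_congr_ae (Eventually.of_forall fun ω => ?_)
        simp only [norm_mul, hen, mul_one, norm_sub_rev]
      calc _ ≤ Real.exp (v / 2) * (1 * ε) := by
            refine mul_le_mul b1 (mul_le_mul hu.2.le b2 (norm_nonneg _) zero_le_one) ?_ (Real.exp_pos _).le
            exact mul_nonneg hu.1 (norm_nonneg _)
        _ = _ := by ring)
  have hψ0 : ψ 0 = 1 := by simp [hψ, hφ]
  have hψ1 : ψ 1 = Complex.exp (((v / 2 : ℝ)) : ℂ) * ∫ ω, Complex.exp (X ω * Complex.I) ∂μ := by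
    simp [hψ, hφ]
  rw [hψ0, hψ1] at hseg
  have : ∫ ω, Complex.exp (X ω * Complex.I) ∂μ - Complex.exp ((-v / 2 : ℝ) : ℂ) =
      Complex.exp ((-v / 2 : ℝ) : ℂ) *
        (Complex.exp (((v / 2 : ℝ)) : ℂ) * ∫ ω, Complex.exp (X ω * Complex.I) ∂μ - 1) := by
    rw [mul_sub, ← mul_assoc, ← Complex.exp_add, mul_one]
    have : ((-v / 2 : ℝ) : ℂ) + ((v / 2 : ℝ) : ℂ) = 0 := by push_cast; ring
    rw [this, Complex.exp_zero, one_mul]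
  rw [this, norm_mul, Complex.norm_exp_ofReal]
  calc _ ≤ Real.exp (-v / 2) * (Real.exp (v / 2) * ε) :=
        mul_le_mul_of_nonneg_left hseg (Real.exp_pos _).le
    _ = ε := by
        rw [← mul_assoc, ← Real.exp_add, show -v / 2 + v / 2 = 0 by ring, Real.exp_zero, one_mul]
end
end

section
open MeasureTheory Matrix Filter Topology
noncomputable section

lemma rot_ne {a : ℕ} (i : Fin (a + 3)) : finRotate (a + 3) i ≠ i := by
  rw [finRotate_apply]
  intro h
  have : (1 : Fin (a + 3)) = 0 := by simpa using h
  have := congrArg Fin.val this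
  simp at this

lemma rot_rot_ne {a : ℕ} (i : Fin (a + 3)) : finRotate (a + 3) (finRotate (a + 3) i) ≠ i := by
  rw [finRotate_apply, finRotate_apply, add_assoc]
  intro h
  have : (1 + 1 : Fin (a + 3)) = 0 := by simpa using h
  have := congrArg Fin.val this
  rw [Fin.val_add] at this
  simp only [Fin.val_one, Fin.val_zero] at this
  rw [Nat.mod_eq_of_lt (by omega)] at this
  omega

lemma rot_trans {a : ℕ} (i j : Fin (a + 3)) : ∃ k : ℤ, (finRotate (a + 3) ^ k) i = j := by
  have h : (finRotate (a + 3)).IsCycle := isCycle_finRotate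
  exact h.sameCycle (rot_ne i) (rot_ne j)

lemma abs_winding_le {V ι : Type*} [DecidableEq V] [Fintype ι] (f g : ι → V) (x y : V) :
    |winding f g x y| ≤ Fintype.card ι := by
  unfold winding
  refine (Finset.abs_sum_le_sum_abs _ _).trans ?_
  have : ∀ i ∈ (Finset.univ : Finset ι), |edgeInd x y (f i) (g i)| ≤ 1 := by
    intro i _
    unfold edgeInd
    split_ifs <;> simp
  refine (Finset.sum_le_sum this).trans ?_
  simp

lemma winding_inj {V : Type*} [DecidableEq V] {a : ℕ} (v : Fin (a + 3) → V)
    (hv : Function.Injective v) (i : Fin (a + 3)) :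
    winding v (fun i => v (finRotate (a + 3) i)) (v i) (v (finRotate (a + 3) i)) = 1 := by
  rw [winding_eq]
  have h1 : (Finset.univ.filter fun j => v j = v i ∧ v (finRotate (a + 3) j) = v (finRotate (a + 3) i)) = {i} := by
    ext j
    simp only [Finset.mem_filter, Finset.mem_univ, true_and, Finset.mem_singleton]
    exact ⟨fun h => hv h.1, fun h => by subst h; exact ⟨rfl, rfl⟩⟩
  have h2 : (Finset.univ.filter fun j => v j = v (finRotate (a + 3) i) ∧ v (finRotate (a + 3) j) = v i) = ∅ := by
    ext j
    simp only [Finset.mem_filter, Finset.mem_univ, true_and, Finset.notMem_empty, iff_false]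
    rintro ⟨h, h'⟩
    have := hv h
    rw [this] at h'
    exact rot_rot_ne i (hv h')
  rw [h1, h2]
  simp

/-- Combined step map on two closed walks. -/
abbrev rot2 (a b : ℕ) : Equiv.Perm (Fin (a + 3) ⊕ Fin (b + 3)) :=
  Equiv.Perm.sumCongr (finRotate (a + 3)) (finRotate (b + 3))

/-- A pair of walks is balanced. -/
def Bal {V : Type*} [DecidableEq V] {a b : ℕ} (v : Fin (a + 3) → V) (w : Fin (b + 3) → V) : Prop :=
  BalSteps (Sum.elim v w) (fun i => Sum.elim v w (rot2 a b i))

lemma winding_pair {V : Type*} [DecidableEq V] {a b : ℕ} (v : Fin (a + 3) → V) (w : Fin (b + 3) → V)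
    (x y : V) : winding (Sum.elim v w) (fun i => Sum.elim v w (rot2 a b i)) x y =
      winding v (fun i => v (finRotate (a + 3) i)) x y +
      winding w (fun i => w (finRotate (b + 3) i)) x y := by
  unfold winding
  rw [Fintype.sum_sum_type]
  rfl

lemma wm_mul (N : ℕ) {a b : ℕ} (v : Fin (a + 3) → Fin N) (w : Fin (b + 3) → Fin N) (ω) :
    wm N v ω * wm N w ω = mono N (Sum.elim v w) (fun i => Sum.elim v w (rot2 a b i)) ω := by
  unfold wm mono
  rw [Fintype.prod_sum_type]
  rfl

lemma pair_ne1 {V : Type*} {a b : ℕ} {v : Fin (a + 3) → V} {w : Fin (b + 3) → V}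
    (hv : Function.Injective v) (hw : Function.Injective w) (i) :
    Sum.elim v w (rot2 a b i) ≠ Sum.elim v w i := by
  rcases i with i | i
  · exact fun h => rot_ne i (hv h)
  · exact fun h => rot_ne i (hw h)

lemma pair_ne2 {V : Type*} {a b : ℕ} {v : Fin (a + 3) → V} {w : Fin (b + 3) → V}
    (hv : Function.Injective v) (hw : Function.Injective w) (i) :
    Sum.elim v w (rot2 a b (rot2 a b i)) ≠ Sum.elim v w i := by
  rcases i with i | i
  · exact fun h => rot_rot_ne i (hv h)
  · exact fun h => rot_rot_ne i (hw h)

lemma bal_ne {V : Type*} [DecidableEq V] {a b : ℕ} (hab : a ≠ b) {v : Fin (a + 3) → V} {w : Fin (b + 3) → V}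
    (hv : Function.Injective v) (hw : Function.Injective w) : ¬ Bal v w := by
  intro hb
  have hp := exists_partner (rot2 a b) (Sum.elim v w) (pair_ne1 hv hw) (pair_ne2 hv hw) hb
  have h1 : ∀ i, ∃ j, w j = v i := by
    intro i
    obtain ⟨j | j, hj, hj2⟩ := hp (Sum.inl i)
    · exact absurd (congrArg Sum.inl (hv hj2)) hj
    · exact ⟨j, hj2⟩
  have h2 : ∀ i, ∃ j, v j = w i := by
    intro i
    obtain ⟨j | j, hj, hj2⟩ := hp (Sum.inr i)
    · exact ⟨j, hj2⟩
    · exact absurd (congrArg Sum.inr (hw hj2)) hj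
  have himg : Finset.univ.image v = Finset.univ.image w := by
    ext x
    simp only [Finset.mem_image, Finset.mem_univ, true_and]
    constructor
    · rintro ⟨i, rfl⟩; exact h1 i
    · rintro ⟨i, rfl⟩; exact h2 i
  have := congrArg Finset.card himg
  rw [Finset.card_image_of_injective _ hv, Finset.card_image_of_injective _ hw] at this
  simp at this
  exact hab this

lemma wm_reverse (N : ℕ) {a : ℕ} (v : Fin (a + 3) → Fin N) (j : Fin (a + 3)) (ω) :
    wm N (fun i => v (j - i)) ω = (starRingEnd ℂ) (wm N v ω) := by
  unfold wm
  rw [conj_mono]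
  unfold mono
  rw [← (Equiv.subLeft j).prod_comp (fun i => ume N ω (v i) (v ((finRotate _)⁻¹ i)))]
  refine Finset.prod_congr rfl fun i _ => ?_
  simp only [Equiv.subLeft_apply]
  have : (finRotate (a + 3))⁻¹ (j - i) = j - finRotate (a + 3) i := by
    rw [Equiv.Perm.inv_eq_iff_eq, finRotate_apply, finRotate_apply]
    abel
  rw [this]

lemma bal_reverse (N : ℕ) {a : ℕ} (v : Fin (a + 3) → Fin N) (hv : Function.Injective v)
    (j : Fin (a + 3)) : Bal v (fun i => v (j - i)) := by
  by_contra h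
  have h0 := integral_mono_eq_zero N _ _ h
  simp_rw [← wm_mul, wm_reverse, Complex.mul_conj'] at h0
  have : ∀ ω, ‖wm N v ω‖ = 1 := by
    intro ω
    unfold wm mono
    rw [norm_prod]
    exact Finset.prod_eq_one fun i _ => norm_ume N ω fun h => rot_ne i (hv h).symm
  simp [this] at h0

lemma bal_eq_reverse {V : Type*} [DecidableEq V] {a : ℕ} {v w : Fin (a + 3) → V}
    (hv : Function.Injective v) (hw : Function.Injective w) (hb : Bal v w) :
    ∃ j, w = fun i => v (j - i) := by
  have hr : ∀ i, ∃ j, w j = v (i + 1) ∧ w (j + 1) = v i := by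
    intro i
    obtain ⟨j | j, hj1, hj2⟩ := exists_reverse (rot2 a a) (Sum.elim v w) (pair_ne1 hv hw) hb (Sum.inl i)
    · simp only [Sum.elim_inl, Equiv.Perm.sumCongr_apply, Sum.map_inl] at hj1 hj2
      rw [hv hj1] at hj2
      exact absurd (hv hj2) (rot_rot_ne i)
    · simp only [Sum.elim_inl, Sum.elim_inr, Equiv.Perm.sumCongr_apply, Sum.map_inl, Sum.map_inr,
        finRotate_apply] at hj1 hj2
      exact ⟨j, hj1, hj2⟩
  have hr2 : ∀ i j, w j = v (i + 1) → w (j + 1) = v i := by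
    intro i j h
    obtain ⟨j', h1, h2⟩ := hr i
    have := hw (h.trans h1.symm)
    rw [this]; exact h2
  obtain ⟨j0, -, hj0⟩ := hr 0
  set j := j0 + 1
  refine ⟨j, ?_⟩
  have key : ∀ k : ℕ, w (j + k • (1 : Fin (a + 3))) = v (-(k • (1 : Fin (a + 3)))) := by
    intro k
    induction k with
    | zero => simpa using hj0
    | succ k ih =>
      have := hr2 (-(k • (1 : Fin (a + 3))) - 1) (j + k • (1 : Fin (a + 3)))
        (by rw [ih]; congr 1; abel)
      rw [succ_nsmul, ← add_assoc, this]
      congr 1; abel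
  funext i
  have hi : (((i - j : Fin (a + 3)) : ℕ)) • (1 : Fin (a + 3)) = i - j := by
    have hk : ∀ k : ℕ, ((k • (1 : Fin (a + 3)) : Fin (a + 3)) : ℕ) = k % (a + 3) := by
      intro k
      induction k with
      | zero => simp
      | succ k ih =>
        rw [succ_nsmul, Fin.val_add, ih]
        simp [Nat.add_mod]
    apply Fin.ext
    rw [hk, Nat.mod_eq_of_lt (Fin.is_lt _)]
  have := key ((i - j : Fin (a + 3)) : ℕ)
  rw [hi] at this
  rw [show j + (i - j) = i by abel, show -(i - j) = j - i by abel] at this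
  exact this

open Classical in
lemma card_bal (N : ℕ) {a : ℕ} (v : Fin (a + 3) → Fin N) (hv : Function.Injective v) :
    (Finset.univ.filter fun w : Fin (a + 3) → Fin N => Function.Injective w ∧ Bal v w).card = a + 3 := by
  have : (Finset.univ.filter fun w : Fin (a + 3) → Fin N => Function.Injective w ∧ Bal v w) =
      Finset.univ.image (fun j : Fin (a + 3) => fun i => v (j - i)) := by
    ext w
    simp only [Finset.mem_filter, Finset.mem_univ, true_and, Finset.mem_image]
    constructor
    · rintro ⟨hw, hb⟩
      obtain ⟨j, rfl⟩ := bal_eq_reverse hv hw hb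
      exact ⟨j, rfl⟩
    · rintro ⟨j, rfl⟩
      exact ⟨fun x y h => by simpa using hv h, bal_reverse N v hv j⟩
  rw [this, Finset.card_image_of_injective]
  · simp
  · intro j j' h
    have := hv (congrFun h 0)
    simpa using this

open Classical in
lemma card_inj (N n : ℕ) :
    (Finset.univ.filter fun v : Fin n → Fin N => Function.Injective v).card = N.descFactorial n := by
  have := Fintype.card_embedding_eq (α := Fin n) (β := Fin N)
  rw [Fintype.card_fin, Fintype.card_fin] at this
  rw [← this, ← Fintype.card_subtype]
  exact Fintype.card_congr (Equiv.subtypeInjectiveEquivEmbedding _ _)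
end
end

section
open MeasureTheory Matrix Filter Topology
noncomputable section

/-- normalisation -/
def cn (N a : ℕ) : ℝ := 1 / (2 * Real.sqrt ((N : ℝ) - 2) ^ (a + 3))

open Classical in
/-- injective closed walks. -/
def injW (N a : ℕ) : Finset (Fin (a + 3) → Fin N) :=
  Finset.univ.filter fun v => Function.Injective v

/-- Sum over simple cycles. -/
def Sc (N a : ℕ) (ω : Fin N → Fin N → ℝ) : ℂ := ∑ v ∈ injW N a, wm N v ω

open Classical in
/-- Remainder. -/
def Rn (N a : ℕ) (ω : Fin N → Fin N → ℝ) : ℂ :=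
  ∑ v ∈ Finset.univ.filter (fun v : Fin (a + 3) → Fin N => NBW v ∧ ¬ Function.Injective v),
    (wm N v ω - ∫ ω', wm N v ω' ∂(phaseMeasure N))

lemma mem_injW {N a : ℕ} {v : Fin (a + 3) → Fin N} : v ∈ injW N a ↔ Function.Injective v := by
  simp [injW]

lemma integrable_wm (N : ℕ) {n : ℕ} (v : Fin n → Fin N) :
    Integrable (wm N v) (phaseMeasure N) := integrable_mono N _ _

lemma continuous_wm (N : ℕ) {n : ℕ} (v : Fin n → Fin N) : Continuous (wm N v) :=
  continuous_mono N _ _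

lemma norm_wm_le (N : ℕ) {n : ℕ} (v : Fin n → Fin N) (ω) : ‖wm N v ω‖ ≤ 1 :=
  norm_mono_le N _ _ ω

lemma integral_wm_inj (N a : ℕ) {v : Fin (a + 3) → Fin N} (hv : Function.Injective v) :
    ∫ ω, wm N v ω ∂(phaseMeasure N) = 0 := by
  apply integral_mono_eq_zero
  intro h
  have h1 := h (v 0) (v (finRotate _ 0)) (fun e => rot_ne 0 (hv e).symm)
  rw [winding_inj v hv] at h1
  norm_num at h1

lemma nbw_inj {N a : ℕ} {v : Fin (a + 3) → Fin N} (hv : Function.Injective v) : NBW v :=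
  fun i h => rot_rot_ne i (hv h)

lemma integrable_cont (N : ℕ) (f : (Fin N → Fin N → ℝ) → ℂ) (hf : Continuous f) (B : ℝ)
    (hB : ∀ ω, ‖f ω‖ ≤ B) : Integrable f (phaseMeasure N) :=
  Integrable.of_bound hf.aestronglyMeasurable B (Eventually.of_forall hB)

open Classical in
lemma centered_eq (N a : ℕ) (hN : 3 ≤ N) (ω) :
    centeredChebTrace N (a + 3) ω = cn N a * ((Sc N a ω).re + (Rn N a ω).re) := by
  unfold centeredChebTrace
  have h1 := fun ω => chebTrace_eq N (a + 2) hN ω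
  simp only [show a + 2 + 1 = a + 3 from rfl] at h1
  simp_rw [h1]
  change (( (cn N a : ℂ) * _ - (cn N a : ℂ) * _ - ∫ ω', ((cn N a : ℂ) * _ - (cn N a : ℂ) * _) ∂_ : ℂ)).re = _
  have hi : Integrable (fun ω => ∑ v : Fin (a + 3) → Fin N, (if NBW v then wm N v ω else 0)) (phaseMeasure N) := by
    refine integrable_finsetSum _ fun v _ => ?_
    split_ifs
    · exact integrable_wm N v
    · exact integrable_zero _ _ _
  rw [integral_sub (hi.const_mul _) (integrable_const _), integral_const_mul, integral_finsetSum]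
  · have e : (Sc N a ω + Rn N a ω) = ∑ v : Fin (a + 3) → Fin N, ((if NBW v then wm N v ω else 0) -
        ∫ ω', (if NBW v then wm N v ω' else 0) ∂(phaseMeasure N)) := by
      unfold Sc Rn injW
      rw [Finset.sum_filter, Finset.sum_filter, ← Finset.sum_add_distrib]
      refine Finset.sum_congr rfl fun v _ => ?_
      by_cases hv : Function.Injective v
      · simp [hv, nbw_inj hv, integral_wm_inj N a hv]
      · by_cases hn : NBW v <;> simp [hv, hn]
    rw [← Complex.add_re, e, ← Complex.re_ofReal_mul, Finset.sum_sub_distrib]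
    congr 1
    simp
    ring
  · intro v _
    split_ifs
    · exact integrable_wm N v
    · exact integrable_zero _ _ _

lemma continuous_Sc (N a : ℕ) : Continuous (Sc N a) :=
  continuous_finsetSum _ fun v _ => continuous_wm N v

lemma continuous_Rn (N a : ℕ) : Continuous (Rn N a) := by
  classical
  exact continuous_finsetSum _ fun v _ => (continuous_wm N v).sub continuous_const

lemma norm_integral_wm_le (N : ℕ) {n : ℕ} (v : Fin n → Fin N) :
    ‖∫ ω', wm N v ω' ∂(phaseMeasure N)‖ ≤ 1 := by
  refine (norm_integral_le_of_norm_le_const (C := 1)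
    (Eventually.of_forall (norm_wm_le N v))).trans ?_
  simp

lemma bounded_Sc (N a : ℕ) : ∃ B, ∀ ω, ‖Sc N a ω‖ ≤ B := by
  refine ⟨∑ v ∈ injW N a, 1, fun ω => ?_⟩
  exact norm_sum_le_of_le _ fun v _ => norm_wm_le N v ω

lemma bounded_Rn (N a : ℕ) : ∃ B, ∀ ω, ‖Rn N a ω‖ ≤ B := by
  classical
  refine ⟨∑ v ∈ Finset.univ.filter (fun v : Fin (a + 3) → Fin N => NBW v ∧ ¬ Function.Injective v), (1 + 1), fun ω => ?_⟩
  exact norm_sum_le_of_le _ fun v _ => (norm_sub_le _ _).trans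
    (add_le_add (norm_wm_le N v ω) (norm_integral_wm_le N v))

lemma integrable_of_cb (N : ℕ) {f : (Fin N → Fin N → ℝ) → ℂ} (hf : Continuous f)
    (hB : ∃ B, ∀ ω, ‖f ω‖ ≤ B) : Integrable f (phaseMeasure N) :=
  integrable_cont N f hf _ hB.choose_spec

lemma integrable_sq_of_cb (N : ℕ) {f : (Fin N → Fin N → ℝ) → ℂ} (hf : Continuous f)
    (hB : ∃ B, ∀ ω, ‖f ω‖ ≤ B) : Integrable (fun ω => ‖f ω‖ ^ 2) (phaseMeasure N) := by
  obtain ⟨B, hB⟩ := hB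
  refine Integrable.of_bound (hf.norm.pow 2).aestronglyMeasurable (B ^ 2)
    (Eventually.of_forall fun ω => ?_)
  rw [Real.norm_of_nonneg (by positivity)]
  exact pow_le_pow_left₀ (norm_nonneg _) (hB ω) 2

lemma wm_eq_zero (N : ℕ) {n : ℕ} {v : Fin n → Fin N} {i : Fin n} (h : v (finRotate n i) = v i) (ω) :
    wm N v ω = 0 := by
  unfold wm mono
  exact Finset.prod_eq_zero (Finset.mem_univ i) (by show ume N ω (v i) (v (finRotate n i)) = 0; rw [h, ume_self])

open Classical in
lemma Rn_bound (N a : ℕ) (hN : 0 < N) :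
    ∫ ω, ‖Rn N a ω‖ ∂(phaseMeasure N) ≤
      Real.sqrt (1 ^ 2 * ((a + 2) ^ (2 * (a + 3)) * N ^ (a + 2) : ℕ)) := by
  apply integral_norm_le_of_sq _ _ (integrable_of_cb N (continuous_Rn N a) (bounded_Rn N a))
    (integrable_sq_of_cb N (continuous_Rn N a) (bounded_Rn N a))
  set S : Finset (Fin (a + 3) → Fin N) :=
    Finset.univ.filter (fun v : Fin (a + 3) → Fin N => (NBW v ∧ ¬ Function.Injective v) ∧
      ∀ i, v (finRotate (a + 3) i) ≠ v i)
  have := var_bound N hN (finRotate (a + 3)) S (fun _ => 1) 1 (fun _ => by simp)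
    (fun v hv => (Finset.mem_filter.1 hv).2.2) (fun v hv => (Finset.mem_filter.1 hv).2.1.1)
    (fun v hv => by
      have := (Finset.mem_filter.1 hv).2.1.2
      rw [Function.not_injective_iff] at this
      obtain ⟨i, j, h1, h2⟩ := this
      refine ⟨i, j, h2, h1, fun b => ?_⟩
      obtain ⟨k, hk⟩ := rot_trans i b
      exact ⟨k, Or.inl hk⟩)
  simp only [Fintype.card_fin] at this
  refine le_trans (le_of_eq ?_) this
  congr 1
  funext ω
  congr 2
  unfold Rn
  symm
  have e : S = (Finset.univ.filter (fun v : Fin (a + 3) → Fin N => NBW v ∧ ¬ Function.Injective v)).filter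
      (fun v => ∀ i, v (finRotate (a + 3) i) ≠ v i) := by
    rw [Finset.filter_filter]
  rw [e, Finset.sum_filter]
  refine Finset.sum_congr rfl fun v _ => ?_
  split_ifs with h
  · rw [one_mul]; rfl
  · push Not at h
    obtain ⟨i, hi⟩ := h
    simp [wm_eq_zero N hi]

lemma Sc_real (N a : ℕ) (ω) : (((Sc N a ω).re : ℝ) : ℂ) = Sc N a ω := by
  rw [← Complex.conj_eq_iff_re]
  unfold Sc
  rw [map_sum]
  refine Finset.sum_nbij' (fun v i => v (0 - i)) (fun v i => v (0 - i)) ?_ ?_ ?_ ?_ ?_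
  · intro v hv
    rw [mem_injW] at *
    exact fun x y h => by simpa using hv h
  · intro v hv
    rw [mem_injW] at *
    exact fun x y h => by simpa using hv h
  · intro v _; funext i; simp
  · intro v _; funext i; simp
  · intro v _
    rw [wm_reverse]

/-- Stein kernel -/
def Gam (N a b : ℕ) (ω : Fin N → Fin N → ℝ) : ℂ :=
  ∑ v ∈ injW N a, ∑ w ∈ injW N b,
    -((winding w (fun i => w (finRotate (b + 3) i)) (v 0) (v (finRotate (a + 3) 0)) : ℤ) : ℂ) *
      (wm N v ω * wm N w ω)

lemma continuous_Gam (N a b : ℕ) : Continuous (Gam N a b) :=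
  continuous_finsetSum _ fun v _ => continuous_finsetSum _ fun w _ =>
    continuous_const.mul ((continuous_wm N v).mul (continuous_wm N w))

lemma bounded_Gam (N a b : ℕ) : ∃ B, ∀ ω, ‖Gam N a b ω‖ ≤ B := by
  refine ⟨∑ v ∈ injW N a, ∑ w ∈ injW N b,
    ‖-((winding w (fun i => w (finRotate (b + 3) i)) (v 0) (v (finRotate (a + 3) 0)) : ℤ) : ℂ)‖,
      fun ω => ?_⟩
  refine norm_sum_le_of_le _ fun v _ => norm_sum_le_of_le _ fun w _ => ?_
  rw [norm_mul, norm_mul]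
  refine mul_le_of_le_one_right (norm_nonneg _) ?_
  exact mul_le_one₀ (norm_wm_le N v ω) (norm_nonneg _) (norm_wm_le N w ω)

/-- mean of Gam -/
def GamMean (N a b : ℕ) : ℂ := if a = b then ((a + 3 : ℕ) * N.descFactorial (a + 3) : ℕ) else 0

open Classical in
lemma term_mean (N a b : ℕ) {v : Fin (a + 3) → Fin N} {w : Fin (b + 3) → Fin N}
    (hv : Function.Injective v) (hw : Function.Injective w) :
    -((winding w (fun i => w (finRotate (b + 3) i)) (v 0) (v (finRotate (a + 3) 0)) : ℤ) : ℂ) *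
      ∫ ω, wm N v ω * wm N w ω ∂(phaseMeasure N) = if Bal v w then 1 else 0 := by
  simp_rw [wm_mul]
  split_ifs with h
  · have h1 : ∀ ω, mono N (Sum.elim v w) (fun i => Sum.elim v w (rot2 a b i)) ω = 1 :=
      mono_eq_one N _ _ (fun i => (pair_ne1 hv hw i).symm) h
    simp_rw [h1]
    have h2 := h (v 0) (v (finRotate _ 0)) (fun e => rot_ne 0 (hv e).symm)
    rw [winding_pair, winding_inj v hv] at h2
    have h3 : winding w (fun i => w (finRotate (b + 3) i)) (v 0) (v (finRotate (a + 3) 0)) = -1 := by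
      linarith
    rw [h3]; simp
  · rw [integral_mono_eq_zero N _ _ h, mul_zero]

lemma mean_eq (N a b : ℕ) :
    ∑ v ∈ injW N a, ∑ w ∈ injW N b,
    -((winding w (fun i => w (finRotate (b + 3) i)) (v 0) (v (finRotate (a + 3) 0)) : ℤ) : ℂ) *
      ∫ ω, wm N v ω * wm N w ω ∂(phaseMeasure N) = GamMean N a b := by
  classical
  have : ∀ v ∈ injW N a, ∑ w ∈ injW N b,
    -((winding w (fun i => w (finRotate (b + 3) i)) (v 0) (v (finRotate (a + 3) 0)) : ℤ) : ℂ) *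
      ∫ ω, wm N v ω * wm N w ω ∂(phaseMeasure N) = if a = b then ((a + 3 : ℕ) : ℂ) else 0 := by
    intro v hv
    rw [mem_injW] at hv
    rw [Finset.sum_congr rfl fun w hw => term_mean N a b hv (mem_injW.1 hw)]
    split_ifs with hab
    · subst hab
      rw [Finset.sum_boole]
      have hcb := card_bal N v hv
      rw [← Finset.filter_filter] at hcb
      exact_mod_cast hcb
    · refine Finset.sum_eq_zero fun w hw => ?_
      rw [if_neg (bal_ne hab hv (mem_injW.1 hw))]
  rw [Finset.sum_congr rfl this, Finset.sum_const, nsmul_eq_mul]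
  unfold GamMean
  have hc : (injW N a).card = N.descFactorial (a + 3) := by
    unfold injW; convert card_inj N (a + 3)
  rw [hc]
  split_ifs
  · push_cast; ring
  · simp

end
end

section
open MeasureTheory Matrix Filter Topology
noncomputable section

lemma winding_zero {V : Type*} [DecidableEq V] {ι : Type*} [Fintype ι] (f g : ι → V) (x y : V)
    (hx : ∀ i, f i ≠ x) (hy : ∀ i, f i ≠ y) : winding f g x y = 0 := by
  unfold winding edgeInd
  simp [hx, hy]

open Classical in
lemma Gam_sub (N a b : ℕ) (ω) : Gam N a b ω - GamMean N a b =
    ∑ f ∈ Finset.univ.filter (fun f : Fin (a + 3) ⊕ Fin (b + 3) → Fin N =>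
      (Function.Injective (fun i => f (Sum.inl i)) ∧ Function.Injective (fun i => f (Sum.inr i))) ∧
      ∃ i j, f (Sum.inl i) = f (Sum.inr j)),
      (-((winding (fun i => f (Sum.inr i)) (fun i => f (Sum.inr (finRotate (b + 3) i)))
        (f (Sum.inl 0)) (f (Sum.inl (finRotate (a + 3) 0))) : ℤ) : ℂ)) *
      (mono N f (fun i => f (rot2 a b i)) ω -
        ∫ ω', mono N f (fun i => f (rot2 a b i)) ω' ∂(phaseMeasure N)) := by
  rw [← Finset.filter_filter, Finset.sum_filter_of_ne]
  · rw [← mean_eq]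
    unfold Gam
    simp_rw [← Finset.sum_sub_distrib, ← mul_sub]
    rw [← Finset.sum_product']
    refine Finset.sum_bij' (fun p _ => Sum.elim p.1 p.2)
      (fun f _ => (fun i => f (Sum.inl i), fun i => f (Sum.inr i))) ?_ ?_ ?_ ?_ ?_
    · rintro ⟨v, w⟩ h
      simp only [Finset.mem_product, mem_injW] at h
      simp only [Finset.mem_filter, Finset.mem_univ, true_and]
      exact h
    · intro f h
      simp only [Finset.mem_filter, Finset.mem_univ, true_and] at h
      simp only [Finset.mem_product, mem_injW]
      exact h
    · rintro ⟨v, w⟩ h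
      rfl
    · intro f h
      funext i
      rcases i with i | i <;> rfl
    · rintro ⟨v, w⟩ h
      simp only [wm_mul]
      rfl
  · intro f _ hne
    by_contra hcon
    push Not at hcon
    apply hne
    rw [winding_zero _ _ _ _ (fun i => (hcon _ i).symm) (fun i => (hcon _ i).symm)]
    simp

open Classical in
lemma Gam_bound (N a b : ℕ) (hN : 0 < N) :
    ∫ ω, ‖Gam N a b ω - GamMean N a b‖ ∂(phaseMeasure N) ≤
      Real.sqrt ((b + 3 : ℝ) ^ 2 * ((a + b + 5) ^ (2 * (a + b + 6)) * N ^ (a + b + 5) : ℕ)) := by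
  have hc : Continuous (fun ω => Gam N a b ω - GamMean N a b) :=
    (continuous_Gam N a b).sub continuous_const
  have hB : ∃ B, ∀ ω, ‖Gam N a b ω - GamMean N a b‖ ≤ B := by
    obtain ⟨B, hB⟩ := bounded_Gam N a b
    exact ⟨B + ‖GamMean N a b‖, fun ω => (norm_sub_le _ _).trans (by gcongr; exact hB ω)⟩
  apply integral_norm_le_of_sq _ _ (integrable_of_cb N hc hB) (integrable_sq_of_cb N hc hB)
  simp_rw [Gam_sub]
  have := var_bound N hN (rot2 a b) (Finset.univ.filter (fun f : Fin (a + 3) ⊕ Fin (b + 3) → Fin N =>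
      (Function.Injective (fun i => f (Sum.inl i)) ∧ Function.Injective (fun i => f (Sum.inr i))) ∧
      ∃ i j, f (Sum.inl i) = f (Sum.inr j)))
      (fun f => (-((winding (fun i => f (Sum.inr i)) (fun i => f (Sum.inr (finRotate (b + 3) i)))
        (f (Sum.inl 0)) (f (Sum.inl (finRotate (a + 3) 0))) : ℤ) : ℂ))) (b + 3 : ℝ) ?_ ?_ ?_ ?_
  · have hcard : Fintype.card (Fin (a + 3) ⊕ Fin (b + 3)) = a + b + 6 := by
      simp; omega
    rw [hcard] at this
    exact this
  · intro f
    rw [norm_neg, Complex.norm_intCast]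
    have := abs_winding_le (fun i => f (Sum.inr i)) (fun i => f (Sum.inr (finRotate (b + 3) i)))
        (f (Sum.inl 0)) (f (Sum.inl (finRotate (a + 3) 0)))
    rw [Fintype.card_fin] at this
    exact_mod_cast this
  · intro f hf i
    have h := (Finset.mem_filter.1 hf).2.1
    have e : f = Sum.elim (fun i => f (Sum.inl i)) (fun i => f (Sum.inr i)) := by
      funext i; rcases i with i | i <;> rfl
    rw [e]
    exact pair_ne1 h.1 h.2 i
  · intro f hf i
    have h := (Finset.mem_filter.1 hf).2.1
    have e : f = Sum.elim (fun i => f (Sum.inl i)) (fun i => f (Sum.inr i)) := by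
      funext i; rcases i with i | i <;> rfl
    rw [e]
    exact pair_ne2 h.1 h.2 i
  · intro f hf
    obtain ⟨i, j, hij⟩ := (Finset.mem_filter.1 hf).2.2
    refine ⟨Sum.inl i, Sum.inr j, by simp, hij, ?_⟩
    rintro (c | c)
    · obtain ⟨k, hk⟩ := rot_trans i c
      exact ⟨k, Or.inl (by rw [sumCongr_zpow]; simp [hk])⟩
    · obtain ⟨k, hk⟩ := rot_trans j c
      exact ⟨k, Or.inr (by rw [sumCongr_zpow]; simp [hk])⟩

/-- Stein variable. -/
def XN (k : ℕ) (t : Fin (k - 2) → ℝ) (N : ℕ) (ω : Fin N → Fin N → ℝ) : ℝ :=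
  ∑ i, t i * (cn N i * (Sc N i ω).re)

/-- Stein kernel. -/
def GN (k : ℕ) (t : Fin (k - 2) → ℝ) (N : ℕ) (ω : Fin N → Fin N → ℝ) : ℂ :=
  ∑ i, ∑ j, ((t i * cn N i * (t j * cn N j) : ℝ) : ℂ) * Gam N i j ω

lemma XN_eq (k : ℕ) (t : Fin (k - 2) → ℝ) (N : ℕ) (ω) :
    ((XN k t N ω : ℝ) : ℂ) = ∑ p ∈ (Finset.univ : Finset (Fin (k - 2))).sigma (fun i => injW N (i : ℕ)),
      ((t p.1 * cn N p.1 : ℝ) : ℂ) * wm N p.2 ω := by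
  unfold XN
  rw [Finset.sum_sigma]
  push_cast
  refine Finset.sum_congr rfl fun i _ => ?_
  rw [Sc_real, Sc, Finset.mul_sum, Finset.mul_sum]
  refine Finset.sum_congr rfl fun v _ => ?_
  ring

lemma stein_one (k : ℕ) (t : Fin (k - 2) → ℝ) (N a : ℕ) (v : Fin (a + 3) → Fin N)
    (hv : Function.Injective v) (u : ℝ) :
    ∫ ω, wm N v ω * Complex.exp (u * (XN k t N ω : ℝ) * Complex.I) ∂(phaseMeasure N) =
    Complex.I * u * ∫ ω, (∑ j : Fin (k - 2), ∑ w ∈ injW N (j : ℕ), ((t j * cn N j : ℝ) : ℂ) *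
      (-((winding w (fun i => w (finRotate ((j : ℕ) + 3) i)) (v 0) (v (finRotate (a + 3) 0)) : ℤ) : ℂ) *
      (wm N v ω * wm N w ω))) * Complex.exp (u * (XN k t N ω : ℝ) * Complex.I) ∂(phaseMeasure N) := by
  have hne : v 0 ≠ v (finRotate (a + 3) 0) := fun e => rot_ne 0 (hv e).symm
  obtain ⟨T, hT, hT2⟩ := exists_shift N hne
  have := abstract_ibp (phaseMeasure N) T hT (wm N v) (continuous_wm N v).measurable (norm_wm_le N v)
    (by
      intro s ω
      have := mono_shift N v (fun i => v (finRotate (a + 3) i)) (hT2 s ω)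
      rw [winding_inj v hv, Int.cast_one, mul_one] at this
      exact this)
    ((Finset.univ : Finset (Fin (k - 2))).sigma (fun i => injW N (i : ℕ)))
    (fun p => ((t p.1 * cn N p.1 : ℝ) : ℂ))
    (fun p => winding p.2 (fun i => p.2 (finRotate ((p.1 : ℕ) + 3) i)) (v 0) (v (finRotate (a + 3) 0)))
    (fun p => wm N p.2) (fun p => (continuous_wm N p.2).measurable) (fun p => norm_wm_le N p.2)
    (fun p s ω => mono_shift N p.2 _ (hT2 s ω)) u
  simp_rw [← XN_eq] at this
  rw [this, neg_mul, neg_mul, ← mul_neg, ← integral_neg]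
  congr 2
  funext ω
  rw [← neg_mul, Finset.sum_sigma, Finset.mul_sum, ← Finset.sum_neg_distrib]
  congr 1
  refine Finset.sum_congr rfl fun j _ => ?_
  rw [Finset.mul_sum, ← Finset.sum_neg_distrib]
  refine Finset.sum_congr rfl fun w _ => ?_
  ring

lemma continuous_XN (k : ℕ) (t : Fin (k - 2) → ℝ) (N : ℕ) : Continuous (XN k t N) :=
  continuous_finsetSum _ fun i _ => continuous_const.mul (continuous_const.mul
    (Complex.continuous_re.comp (continuous_Sc N i)))

lemma continuous_GN (k : ℕ) (t : Fin (k - 2) → ℝ) (N : ℕ) : Continuous (GN k t N) :=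
  continuous_finsetSum _ fun i _ => continuous_finsetSum _ fun j _ =>
    continuous_const.mul (continuous_Gam N i j)

lemma integrable_GN (k : ℕ) (t : Fin (k - 2) → ℝ) (N : ℕ) : Integrable (GN k t N) (phaseMeasure N) :=
  integrable_finsetSum _ fun i _ => integrable_finsetSum _ fun j _ =>
    (integrable_of_cb N (continuous_Gam N i j) (bounded_Gam N i j)).const_mul _

lemma integrable_mul_exp (k : ℕ) (t : Fin (k - 2) → ℝ) (N : ℕ) (u : ℝ) {f : (Fin N → Fin N → ℝ) → ℂ}
    (hf : Integrable f (phaseMeasure N)) :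
    Integrable (fun ω => f ω * Complex.exp (u * (XN k t N ω : ℝ) * Complex.I)) (phaseMeasure N) := by
  refine hf.mul_bdd (c := 1) ?_ (Eventually.of_forall fun ω => ?_)
  · have := continuous_XN k t N
    refine Continuous.aestronglyMeasurable ?_
    fun_prop
  · rw [show (u : ℂ) * (XN k t N ω : ℝ) = ((u * XN k t N ω : ℝ) : ℂ) by push_cast; rfl,
      Complex.norm_exp_ofReal_mul_I]

lemma stein_XN (k : ℕ) (t : Fin (k - 2) → ℝ) (N : ℕ) (u : ℝ) :
    ∫ ω, (XN k t N ω : ℂ) * Complex.exp (u * XN k t N ω * Complex.I) ∂(phaseMeasure N) =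
      Complex.I * u * ∫ ω, GN k t N ω * Complex.exp (u * XN k t N ω * Complex.I) ∂(phaseMeasure N) := by
  have e1 : ∀ ω, (XN k t N ω : ℂ) * Complex.exp (u * XN k t N ω * Complex.I) =
      ∑ i : Fin (k - 2), ∑ v ∈ injW N (i : ℕ), ((t i * cn N i : ℝ) : ℂ) *
        (wm N v ω * Complex.exp (u * XN k t N ω * Complex.I)) := by
    intro ω
    have hX := XN_eq k t N ω
    rw [Finset.sum_sigma] at hX
    generalize Complex.exp (u * XN k t N ω * Complex.I) = z
    rw [hX, Finset.sum_mul]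
    refine Finset.sum_congr rfl fun i _ => ?_
    rw [Finset.sum_mul]
    refine Finset.sum_congr rfl fun v _ => ?_
    ring
  simp_rw [e1]
  have hIntA : ∀ (i : Fin (k - 2)) (v : Fin ((i : ℕ) + 3) → Fin N), Integrable (fun ω =>
      ((t i * cn N i : ℝ) : ℂ) * (wm N v ω * Complex.exp (u * XN k t N ω * Complex.I)))
      (phaseMeasure N) := fun i v => (integrable_mul_exp k t N u (integrable_wm N v)).const_mul _
  rw [integral_finsetSum _ fun i _ => integrable_finsetSum _ fun v _ => hIntA i v]
  simp_rw [integral_finsetSum _ fun v _ => hIntA _ v, integral_const_mul]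
  have e2 : ∀ ω, GN k t N ω * Complex.exp (u * XN k t N ω * Complex.I) =
     ∑ i : Fin (k - 2), ∑ v ∈ injW N (i : ℕ), ((t i * cn N i : ℝ) : ℂ) *
      ((∑ j : Fin (k - 2), ∑ w ∈ injW N (j : ℕ), ((t j * cn N j : ℝ) : ℂ) *
      (-((winding w (fun i => w (finRotate ((j : ℕ) + 3) i)) (v 0) (v (finRotate ((i : ℕ) + 3) 0)) : ℤ) : ℂ) *
      (wm N v ω * wm N w ω))) * Complex.exp (u * XN k t N ω * Complex.I)) := by
    intro ω
    simp_rw [← mul_assoc, ← Finset.sum_mul]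
    congr 1
    unfold GN Gam
    refine Finset.sum_congr rfl fun i _ => ?_
    simp_rw [Finset.mul_sum]
    rw [Finset.sum_comm]
    refine Finset.sum_congr rfl fun v _ => ?_
    refine Finset.sum_congr rfl fun j _ => ?_
    refine Finset.sum_congr rfl fun w _ => ?_
    push_cast
    ring
  simp_rw [e2]
  have hIntB : ∀ (i : Fin (k - 2)) (v : Fin ((i : ℕ) + 3) → Fin N), Integrable (fun ω =>
      ((t i * cn N i : ℝ) : ℂ) * ((∑ j : Fin (k - 2), ∑ w ∈ injW N (j : ℕ), ((t j * cn N j : ℝ) : ℂ) *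
      (-((winding w (fun i => w (finRotate ((j : ℕ) + 3) i)) (v 0) (v (finRotate ((i : ℕ) + 3) 0)) : ℤ) : ℂ) *
      (wm N v ω * wm N w ω))) * Complex.exp (u * XN k t N ω * Complex.I)))
      (phaseMeasure N) := by
    intro i v
    refine (integrable_mul_exp k t N u ?_).const_mul _
    refine integrable_finsetSum _ fun j _ => integrable_finsetSum _ fun w _ => ?_
    refine Integrable.const_mul (Integrable.const_mul ?_ _) _
    simp_rw [wm_mul]
    exact integrable_mono N _ _
  rw [integral_finsetSum _ fun i _ => integrable_finsetSum _ fun v _ => hIntB i v]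
  simp_rw [integral_finsetSum _ fun v _ => hIntB _ v, integral_const_mul]
  rw [Finset.mul_sum]
  refine Finset.sum_congr rfl fun i _ => ?_
  rw [Finset.mul_sum]
  refine Finset.sum_congr rfl fun v hv => ?_
  rw [stein_one k t N _ v (mem_injW.1 hv) u]
  ring

end
end

section
open MeasureTheory Matrix Filter Topology
noncomputable section

lemma tendsto_ratio : Tendsto (fun N : ℕ => (N : ℝ) / ((N : ℝ) - 2)) atTop (𝓝 1) := by
  have h : Tendsto (fun N : ℕ => 1 + 2 * ((N : ℝ) - 2)⁻¹) atTop (𝓝 (1 + 2 * 0)) := by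
    refine tendsto_const_nhds.add (Tendsto.const_mul _ (tendsto_inv_atTop_zero.comp ?_))
    exact tendsto_atTop_add_const_right _ _ tendsto_natCast_atTop_atTop
  rw [mul_zero, add_zero] at h
  refine h.congr' ?_
  filter_upwards [eventually_ge_atTop 3] with N hN
  have : (3 : ℝ) ≤ N := by exact_mod_cast hN
  have : (N : ℝ) - 2 ≠ 0 := by linarith
  field_simp
  ring

lemma tendsto_sub_ratio (j : ℕ) :
    Tendsto (fun N : ℕ => ((N - j : ℕ) : ℝ) / ((N : ℝ) - 2)) atTop (𝓝 1) := by
  have h : Tendsto (fun N : ℕ => (N : ℝ) / ((N : ℝ) - 2) - j * ((N : ℝ) - 2)⁻¹) atTop (𝓝 (1 - j * 0)) := by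
    refine tendsto_ratio.sub (Tendsto.const_mul _ (tendsto_inv_atTop_zero.comp ?_))
    exact tendsto_atTop_add_const_right _ _ tendsto_natCast_atTop_atTop
  rw [mul_zero, sub_zero] at h
  refine h.congr' ?_
  filter_upwards [eventually_ge_atTop j] with N hN
  rw [Nat.cast_sub hN]
  ring

lemma tendsto_desc (n : ℕ) :
    Tendsto (fun N : ℕ => (N.descFactorial n : ℝ) / ((N : ℝ) - 2) ^ n) atTop (𝓝 1) := by
  induction n with
  | zero => simp
  | succ n ih =>
    have := (tendsto_sub_ratio n).mul ih
    rw [one_mul] at this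
    refine this.congr fun N => ?_
    rw [Nat.descFactorial_succ, pow_succ', Nat.cast_mul, div_mul_div_comm]

lemma tendsto_small (K : ℝ) (hK : 0 ≤ K) (p : ℕ) :
    Tendsto (fun N : ℕ => Real.sqrt (K * (N : ℝ) ^ p) / Real.sqrt ((N : ℝ) - 2) ^ (p + 1)) atTop (𝓝 0) := by
  have h1 : Tendsto (fun N : ℕ => Real.sqrt ((N : ℝ) / ((N : ℝ) - 2))) atTop (𝓝 1) := by
    have := (Real.continuous_sqrt.tendsto 1).comp tendsto_ratio
    rw [Real.sqrt_one] at this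
    exact this
  have h2 : Tendsto (fun N : ℕ => (Real.sqrt ((N : ℝ) - 2))⁻¹) atTop (𝓝 0) := by
    refine tendsto_inv_atTop_zero.comp (Real.tendsto_sqrt_atTop.comp ?_)
    exact tendsto_atTop_add_const_right _ _ tendsto_natCast_atTop_atTop
  have h3 := ((h1.pow p).mul h2).const_mul (Real.sqrt K)
  rw [mul_zero, mul_zero] at h3
  refine h3.congr fun N => ?_
  have hs : Real.sqrt ((N : ℝ) ^ p) = Real.sqrt N ^ p := by
    rw [show (N : ℝ) ^ p = (Real.sqrt N ^ p) ^ 2 by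
      rw [← pow_mul, mul_comm, pow_mul, Real.sq_sqrt (Nat.cast_nonneg N)]]
    exact Real.sqrt_sq (by positivity)
  rw [Real.sqrt_mul hK, hs, Real.sqrt_div (Nat.cast_nonneg N), div_pow, pow_succ, div_eq_mul_inv,
    div_eq_mul_inv, mul_inv]
  ring

lemma cn_nonneg (N a : ℕ) : 0 ≤ cn N a := by unfold cn; positivity

lemma tendsto_cn_Rn (a : ℕ) :
    Tendsto (fun N : ℕ => cn N a * ∫ ω, ‖Rn N a ω‖ ∂(phaseMeasure N)) atTop (𝓝 0) := by
  have h := (tendsto_small (((a + 2) ^ (2 * (a + 3)) : ℕ) : ℝ) (Nat.cast_nonneg _) (a + 2)).const_mul (1 / 2)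
  rw [mul_zero] at h
  refine squeeze_zero' (Eventually.of_forall fun N => mul_nonneg (cn_nonneg N a)
    (integral_nonneg fun ω => norm_nonneg _)) ?_ h
  filter_upwards [eventually_gt_atTop 0] with N hN
  refine (mul_le_mul_of_nonneg_left (Rn_bound N a hN) (cn_nonneg N a)).trans (le_of_eq ?_)
  unfold cn
  push_cast
  rw [one_pow, one_mul, show a + 2 + 1 = a + 3 from rfl, one_div, mul_inv]
  ring

lemma tendsto_cn_Gam (a b : ℕ) :
    Tendsto (fun N : ℕ => cn N a * cn N b *
      ∫ ω, ‖Gam N a b ω - GamMean N a b‖ ∂(phaseMeasure N)) atTop (𝓝 0) := by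
  have h := (tendsto_small ((b + 3 : ℝ) ^ 2 * ((a + b + 5) ^ (2 * (a + b + 6)) : ℕ))
    (by positivity) (a + b + 5)).const_mul (1 / 4)
  rw [mul_zero] at h
  refine squeeze_zero' (Eventually.of_forall fun N => mul_nonneg (mul_nonneg (cn_nonneg N a)
    (cn_nonneg N b)) (integral_nonneg fun ω => norm_nonneg _)) ?_ h
  filter_upwards [eventually_gt_atTop 0] with N hN
  refine (mul_le_mul_of_nonneg_left (Gam_bound N a b hN)
    (mul_nonneg (cn_nonneg N a) (cn_nonneg N b))).trans (le_of_eq ?_)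
  unfold cn
  push_cast
  rw [show a + b + 5 + 1 = (a + 3) + (b + 3) by ring, pow_add _ (a + 3), ← mul_assoc, one_div]
  generalize Real.sqrt (_ * _) = z
  field_simp
  ring

lemma tendsto_cn_mean (a b : ℕ) :
    Tendsto (fun N : ℕ => ((cn N a * cn N b : ℝ) : ℂ) * GamMean N a b) atTop
      (𝓝 (if a = b then (((a : ℝ) + 3) / 4 : ℝ) else 0)) := by
  unfold GamMean
  split_ifs with h
  · subst h
    have h := (tendsto_desc (a + 3)).const_mul (((a : ℝ) + 3) / 4)
    rw [mul_one] at h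
    have h' := (Complex.continuous_ofReal.tendsto _).comp h
    refine h'.congr' ?_
    filter_upwards [eventually_ge_atTop 3] with N hN
    have hN' : (3 : ℝ) ≤ N := by exact_mod_cast hN
    have e : cn N a * cn N a = 1 / (4 * ((N : ℝ) - 2) ^ (a + 3)) := by
      unfold cn
      have : ((N : ℝ) - 2) ^ (a + 3) = Real.sqrt ((N : ℝ) - 2) ^ (a + 3) * Real.sqrt ((N : ℝ) - 2) ^ (a + 3) := by
        rw [← mul_pow, Real.mul_self_sqrt (by linarith)]
      rw [this, div_mul_div_comm]
      congr 1 <;> ring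
    rw [e, Function.comp]
    rw [← Complex.ofReal_natCast, ← Complex.ofReal_mul]
    congr 1
    push_cast
    have : ((N : ℝ) - 2) ^ (a + 3) ≠ 0 := pow_ne_zero _ (by linarith)
    field_simp
  · simp

lemma norm_cexp_sub_le (x y : ℝ) :
    ‖Complex.exp (x * Complex.I) - Complex.exp (y * Complex.I)‖ ≤ |x - y| := by
  have h : Complex.exp (x * Complex.I) - Complex.exp (y * Complex.I) =
      Complex.exp (y * Complex.I) * (Complex.exp (Complex.I * ((x - y : ℝ) : ℂ)) - 1) := by
    rw [mul_sub, ← Complex.exp_add, mul_one]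
    congr 2
    push_cast
    ring
  rw [h, norm_mul, Complex.norm_exp_ofReal_mul_I, one_mul]
  exact Real.norm_exp_I_mul_ofReal_sub_one_le

lemma diff_bound (k : ℕ) (t : Fin (k - 2) → ℝ) (N : ℕ) (hN : 3 ≤ N) :
    ‖∫ ω, Complex.exp (((∑ i, t i * centeredChebTrace N ((i : ℕ) + 3) ω : ℝ) : ℂ) * Complex.I)
        ∂(phaseMeasure N) -
      ∫ ω, Complex.exp ((XN k t N ω : ℝ) * Complex.I) ∂(phaseMeasure N)‖ ≤
    ∑ i : Fin (k - 2), |t i| * (cn N i * ∫ ω, ‖Rn N i ω‖ ∂(phaseMeasure N)) := by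
  have hb : ∀ (Y : (Fin N → Fin N → ℝ) → ℝ), Continuous Y →
      Integrable (fun ω => Complex.exp ((Y ω : ℝ) * Complex.I)) (phaseMeasure N) := by
    intro Y hY
    refine integrable_cont N _ (by fun_prop) 1 fun ω => ?_
    rw [Complex.norm_exp_ofReal_mul_I]
  have hc : Continuous (fun ω => ∑ i : Fin (k - 2), t i * centeredChebTrace N ((i : ℕ) + 3) ω) :=
    continuous_finsetSum _ fun i _ => continuous_const.mul (continuous_centered N _)
  rw [← integral_sub (hb _ hc) (hb _ (continuous_XN k t N))]
  have hRi : ∀ i : Fin (k - 2), Integrable (fun ω => |t i| * (cn N i * ‖Rn N i ω‖)) (phaseMeasure N) :=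
    fun i => ((integrable_of_cb N (continuous_Rn N i) (bounded_Rn N i)).norm.const_mul _).const_mul _
  have e : ∑ i : Fin (k - 2), |t i| * (cn N i * ∫ ω, ‖Rn N i ω‖ ∂(phaseMeasure N)) =
      ∫ ω, ∑ i : Fin (k - 2), |t i| * (cn N i * ‖Rn N i ω‖) ∂(phaseMeasure N) := by
    rw [integral_finsetSum _ fun i _ => hRi i]
    simp_rw [integral_const_mul]
  rw [e]
  refine norm_integral_le_of_norm_le (integrable_finsetSum _ fun i _ => hRi i)
    (Eventually.of_forall fun ω => ?_)
  refine (norm_cexp_sub_le _ _).trans ?_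
  unfold XN
  rw [← Finset.sum_sub_distrib]
  refine (Finset.abs_sum_le_sum_abs _ _).trans (Finset.sum_le_sum fun i _ => ?_)
  rw [centered_eq N i hN, ← mul_sub, ← mul_sub, add_sub_cancel_left, abs_mul, abs_mul,
    abs_of_nonneg (cn_nonneg N i)]
  gcongr
  · exact cn_nonneg N i
  · exact Complex.abs_re_le_norm _

/-- Mean of the kernel. -/
def GNMean (k : ℕ) (t : Fin (k - 2) → ℝ) (N : ℕ) : ℂ :=
  ∑ i, ∑ j, ((t i * cn N i * (t j * cn N j) : ℝ) : ℂ) * GamMean N (i : ℕ) (j : ℕ)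

lemma tendsto_GNMean (k : ℕ) (t : Fin (k - 2) → ℝ) :
    Tendsto (GNMean k t) atTop (𝓝 ((∑ i, t i ^ 2 * (((i : ℕ) + 3 : ℝ) / 4) : ℝ) : ℂ)) := by
  have h : Tendsto (GNMean k t) atTop (𝓝 (∑ i : Fin (k - 2), ∑ j : Fin (k - 2), ((t i * t j : ℝ) : ℂ) *
      (if (i : ℕ) = (j : ℕ) then ((((i : ℕ) : ℝ) + 3) / 4 : ℝ) else 0 : ℂ))) := by
    refine tendsto_finsetSum _ fun i _ => tendsto_finsetSum _ fun j _ => ?_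
    refine ((tendsto_cn_mean (i : ℕ) (j : ℕ)).const_mul ((t i * t j : ℝ) : ℂ)).congr fun N => ?_
    push_cast
    ring
  convert h using 2
  push_cast
  refine Finset.sum_congr rfl fun i _ => ?_
  simp_rw [← Fin.ext_iff]
  rw [Finset.sum_eq_single i (fun j _ hj => by rw [if_neg (Ne.symm hj), mul_zero]) (by simp), if_pos rfl]
  ring

lemma GN_bound (k : ℕ) (t : Fin (k - 2) → ℝ) (N : ℕ) (v : ℝ) :
    ∫ ω, ‖GN k t N ω - v‖ ∂(phaseMeasure N) ≤
      (∑ i : Fin (k - 2), ∑ j : Fin (k - 2), |t i * t j| * (cn N i * cn N j *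
        ∫ ω, ‖Gam N i j ω - GamMean N i j‖ ∂(phaseMeasure N))) + ‖GNMean k t N - v‖ := by
  have hIntA : ∀ i j : Fin (k - 2), Integrable (fun ω => |t i * t j| * (cn N i * cn N j *
        ‖Gam N i j ω - GamMean N i j‖)) (phaseMeasure N) := fun i j =>
    (((integrable_of_cb N (continuous_Gam N i j) (bounded_Gam N i j)).sub
      (integrable_const _)).norm.const_mul _).const_mul _
  have e : (∑ i : Fin (k - 2), ∑ j : Fin (k - 2), |t i * t j| * (cn N i * cn N j *
        ∫ ω, ‖Gam N i j ω - GamMean N i j‖ ∂(phaseMeasure N))) + ‖GNMean k t N - v‖ =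
      ∫ ω, ((∑ i : Fin (k - 2), ∑ j : Fin (k - 2), |t i * t j| * (cn N i * cn N j *
        ‖Gam N i j ω - GamMean N i j‖)) + ‖GNMean k t N - v‖) ∂(phaseMeasure N) := by
    rw [integral_add (integrable_finsetSum _ fun i _ => integrable_finsetSum _ fun j _ => hIntA i j)
      (integrable_const _),
      integral_finsetSum _ fun i _ => integrable_finsetSum _ fun j _ => hIntA i j]
    simp_rw [integral_finsetSum _ fun j _ => hIntA _ j, integral_const_mul]
    simp
  rw [e]
  refine integral_mono ((integrable_GN k t N).sub (integrable_const _)).norm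
    ((integrable_finsetSum _ fun i _ => integrable_finsetSum _ fun j _ => hIntA i j).add
      (integrable_const _)) fun ω => ?_
  have e2 : GN k t N ω - v = (∑ i : Fin (k - 2), ∑ j : Fin (k - 2), ((t i * cn N i * (t j * cn N j) : ℝ) : ℂ) *
      (Gam N i j ω - GamMean N i j)) + (GNMean k t N - v) := by
    unfold GN GNMean
    simp_rw [mul_sub, Finset.sum_sub_distrib]
    ring
  simp only
  rw [e2]
  refine (norm_add_le _ _).trans ?_
  gcongr
  refine norm_sum_le_of_le _ fun i _ => norm_sum_le_of_le _ fun j _ => ?_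
  rw [norm_mul, Complex.norm_real, Real.norm_eq_abs,
    show t i * cn N i * (t j * cn N j) = t i * t j * (cn N i * cn N j) by ring, abs_mul _ (cn N i * cn N j),
    abs_of_nonneg (mul_nonneg (cn_nonneg N i) (cn_nonneg N j)), mul_assoc]

lemma XN_bounded (k : ℕ) (t : Fin (k - 2) → ℝ) (N : ℕ) : ∃ B, ∀ ω, |XN k t N ω| ≤ B := by
  refine ⟨∑ i : Fin (k - 2), |t i| * (cn N i * (bounded_Sc N i).choose), fun ω => ?_⟩
  unfold XN
  refine (Finset.abs_sum_le_sum_abs _ _).trans (Finset.sum_le_sum fun i _ => ?_)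
  rw [abs_mul, abs_mul, abs_of_nonneg (cn_nonneg N i)]
  gcongr
  · exact cn_nonneg N i
  · exact (Complex.abs_re_le_norm _).trans ((bounded_Sc N i).choose_spec ω)

theorem char_tendsto (k : ℕ) (t : Fin (k - 2) → ℝ) : Tendsto (fun N : ℕ => ∫ ω, Complex.exp
        (((∑ i, t i * centeredChebTrace N ((i : ℕ) + 3) ω : ℝ) : ℂ) * Complex.I) ∂(phaseMeasure N))
        atTop (𝓝 (Complex.exp ((-(∑ i, t i ^ 2 * (((i : ℕ) + 3 : ℝ) / 4)) / 2 : ℝ)))) := by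
  set v : ℝ := ∑ i, t i ^ 2 * (((i : ℕ) + 3 : ℝ) / 4) with hv
  have hv0 : 0 ≤ v := Finset.sum_nonneg fun i _ => by positivity
  rw [tendsto_iff_norm_sub_tendsto_zero]
  have l1 : Tendsto (fun N : ℕ => ∑ i : Fin (k - 2), |t i| * (cn N i * ∫ ω, ‖Rn N i ω‖ ∂(phaseMeasure N)))
      atTop (𝓝 (∑ i : Fin (k - 2), |t i| * 0)) :=
    tendsto_finsetSum _ fun i _ => (tendsto_cn_Rn i).const_mul _
  have l2 : Tendsto (fun N : ℕ => ∑ i : Fin (k - 2), ∑ j : Fin (k - 2), |t i * t j| * (cn N i * cn N j *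
        ∫ ω, ‖Gam N i j ω - GamMean N i j‖ ∂(phaseMeasure N)))
      atTop (𝓝 (∑ i : Fin (k - 2), ∑ j : Fin (k - 2), |t i * t j| * 0)) :=
    tendsto_finsetSum _ fun i _ => tendsto_finsetSum _ fun j _ => (tendsto_cn_Gam i j).const_mul _
  have l3 := tendsto_iff_norm_sub_tendsto_zero.1 (tendsto_GNMean k t)
  rw [← hv] at l3
  have l := l1.add (l2.add l3)
  simp only [mul_zero, Finset.sum_const_zero, add_zero] at l
  refine squeeze_zero' (Eventually.of_forall fun N => norm_nonneg _) ?_ l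
  filter_upwards [eventually_ge_atTop 3] with N hN
  obtain ⟨B, hB⟩ := XN_bounded k t N
  have s := abstract_stein (phaseMeasure N) (XN k t N) (continuous_XN k t N).measurable B hB (GN k t N)
    (integrable_GN k t N) v _ hv0 (stein_XN k t N) (GN_bound k t N v)
  exact (norm_sub_le_norm_sub_add_norm_sub _ _ _).trans (add_le_add (diff_bound k t N hN) s)

end
end

/-- CLT for Chebyshev traces of the UME: for fixed `k ≥ 3`, the random vector
`F(M_N) = (F_3(M_N), …, F_k(M_N))` of centered Chebyshev traces converges in distribution,
as `N → ∞`, to a vector of independent centered Gaussians with variances `n/4`: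
the expectation of every bounded continuous test function converges. -/
theorem ume_chebyshev_clt (k : ℕ) (hk : 3 ≤ k) :
    ∀ f : (Fin (k - 2) → ℝ) → ℝ, Continuous f → (∃ C : ℝ, ∀ x, |f x| ≤ C) →
      Filter.Tendsto
        (fun N : ℕ =>
          ∫ ω, f (fun i => centeredChebTrace N ((i : ℕ) + 3) ω) ∂(phaseMeasure N))
        Filter.atTop (nhds (∫ z, f z ∂(gaussLimit k))) := by
  exact levy_reduction k (char_tendsto k)
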